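/- Let d ∈ ℕ and 1 < p ≤ 2. (1) If p ≤ η ≤ ∞ and r > 2/p − 1, then σ_m(S^r_p W)_{A_η} ≍ m^{−(r + 1 − 1/p − 1/η)} · (log* m)^{(d−1)(r + 1 − 2/p)}. (2) If p < η ≤ ∞ and r = 2/p − 1, then σ_m(S^r_p W)_{A_η} ≍ m^{−(1/p − 1/η)}. -/

import Mathlib

open MeasureTheory Real ENNReal

noncomputable section

namespace Paper

/-- The fundamental domain `[0,1)^d` of the `d`-dimensional torus `𝕋^d`. -/
def cube (d : ℕ) : Set (Fin d → ℝ) := Set.univ.pi fun _ => Set.Ico (0:ℝ) 1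

/-- The trigonometric character `x ↦ e^{2π i k·x}`. -/
def expk (d : ℕ) (k : Fin d → ℤ) (x : Fin d → ℝ) : ℂ :=
  Complex.exp (((2 * Real.pi * ∑ i, (k i : ℝ) * x i : ℝ) : ℂ) * Complex.I)

/-- Fourier coefficient `f̂(k) = ∫_{[0,1)^d} f(x) e^{-2π i k·x} dx`. -/
def fCoeff (d : ℕ) (f : (Fin d → ℝ) → ℂ) (k : Fin d → ℤ) : ℂ :=
  ∫ x in cube d, f x * expk d (-k) x

/-- The `L_q` (quasi-)norm on the torus, `q ∈ (0,∞]`, valued in `ℝ≥0∞`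
(for `q = ∞` this is the essential supremum). -/
def LqNorm (d : ℕ) (q : ℝ≥0∞) (f : (Fin d → ℝ) → ℂ) : ℝ≥0∞ :=
  eLpNorm f q (volume.restrict (cube d))

/-- The weight `∏_{i=1}^d (1+|k_i|)`. -/
def wt (d : ℕ) (k : Fin d → ℤ) : ℝ := ∏ i, (1 + |(k i : ℝ)|)

/-- The weighted Wiener (quasi-)norm `‖f‖_{S^r_θ A}`
(with the sup modification for `θ = ∞`); `A_θ` corresponds to `r = 0`,
the Wiener algebra `A` to `r = 0`, `θ = 1`. -/
def wienerNorm (d : ℕ) (r : ℝ) (θ : ℝ≥0∞) (f : (Fin d → ℝ) → ℂ) : ℝ≥0∞ :=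
  if θ = ∞ then ⨆ k : Fin d → ℤ, ENNReal.ofReal (wt d k ^ r) * (‖fCoeff d f k‖₊ : ℝ≥0∞)
  else (∑' k : Fin d → ℤ,
      (ENNReal.ofReal (wt d k ^ r) * (‖fCoeff d f k‖₊ : ℝ≥0∞)) ^ θ.toReal) ^ (1 / θ.toReal)

/-- Trigonometric polynomials with at most `m` terms. -/
def trigPoly (d m : ℕ) : Set ((Fin d → ℝ) → ℂ) :=
  {s | ∃ (Λ : Finset (Fin d → ℤ)) (a : (Fin d → ℤ) → ℂ),
    Λ.card ≤ m ∧ s = fun x => ∑ k ∈ Λ, a k * expk d k x}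

/-- Best `m`-term trigonometric approximation error of `f`, error measured by `X`. -/
def sigmaF (d m : ℕ) (X : ((Fin d → ℝ) → ℂ) → ℝ≥0∞) (f : (Fin d → ℝ) → ℂ) : ℝ≥0∞ :=
  ⨅ s ∈ trigPoly d m, X (f - s)

/-- The unit ball of the space (inside `L₁(𝕋^d)`) with (quasi-)norm `N`. -/
def unitBall (d : ℕ) (N : ((Fin d → ℝ) → ℂ) → ℝ≥0∞) : Set ((Fin d → ℝ) → ℂ) :=
  {f | IntegrableOn f (cube d) ∧ N f ≤ 1}

/-- Best `m`-term trigonometric width of the unit ball of `N`, error measured by `X`. -/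
def sigmaClass (d m : ℕ) (N X : ((Fin d → ℝ) → ℂ) → ℝ≥0∞) : ℝ≥0∞ :=
  ⨆ f ∈ unitBall d N, sigmaF d m X f

/-- `log*(m) = max (log₂ m) 1`. -/
def logStar (m : ℕ) : ℝ := max (Real.logb 2 m) 1

/-- Two-sided asymptotic equivalence `a_m ≍ b_m`. -/
def IsAsympEquiv (a : ℕ → ℝ≥0∞) (b : ℕ → ℝ) : Prop :=
  ∃ c C : ℝ, 0 < c ∧ 0 < C ∧ ∃ m₀ : ℕ, ∀ m : ℕ, m₀ ≤ m →
    ENNReal.ofReal (c * b m) ≤ a m ∧ a m ≤ ENNReal.ofReal (C * b m)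

/-- One-sided asymptotic bound `a_m ≲ b_m`. -/
def IsAsympLe (a : ℕ → ℝ≥0∞) (b : ℕ → ℝ) : Prop :=
  ∃ C : ℝ, 0 < C ∧ ∃ m₀ : ℕ, ∀ m : ℕ, m₀ ≤ m → a m ≤ ENNReal.ofReal (C * b m)

/-- Dyadic block `I_0 = {0}`, `I_n = {k : 2^{n-1} ≤ |k| < 2^n}` for `n ≥ 1`. -/
def blockF (n : ℕ) : Finset ℤ :=
  (Finset.Icc (-(2^n : ℤ)) (2^n)).filter fun k =>
    (n = 0 ∧ k = 0) ∨ (n ≠ 0 ∧ 2^(n-1) ≤ |k| ∧ |k| < 2^n)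

/-- The dyadic block projection `∑_{k ∈ I_j} f̂(k) e^{2π i k·x}`. -/
def blockProj (d : ℕ) (f : (Fin d → ℝ) → ℂ) (j : Fin d → ℕ) : (Fin d → ℝ) → ℂ :=
  fun x => ∑ k ∈ Fintype.piFinset (fun i => blockF (j i)), fCoeff d f k * expk d k x

/-- The mixed-smoothness Besov (quasi-)norm `‖f‖_{S^s_{p,θ}B}`
(with the sup modification for `θ = ∞`). -/
def besovNorm (d : ℕ) (s : ℝ) (p θ : ℝ≥0∞) (f : (Fin d → ℝ) → ℂ) : ℝ≥0∞ :=
  if θ = ∞ then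
    ⨆ j : Fin d → ℕ,
      ENNReal.ofReal ((2:ℝ) ^ (((∑ i, j i : ℕ) : ℝ) * s)) * LqNorm d p (blockProj d f j)
  else
    (∑' j : Fin d → ℕ,
      (ENNReal.ofReal ((2:ℝ) ^ (((∑ i, j i : ℕ) : ℝ) * s)) * LqNorm d p (blockProj d f j))
        ^ θ.toReal) ^ (1 / θ.toReal)

/-- The mixed-smoothness Sobolev norm `‖f‖_{S^s_p W}` (Littlewood–Paley form),
with `S^0_p W := L_p`. -/
def sobolevNorm (d : ℕ) (s : ℝ) (p : ℝ≥0∞) (f : (Fin d → ℝ) → ℂ) : ℝ≥0∞ :=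
  if s = 0 then LqNorm d p f
  else
    (∫⁻ x in cube d,
      ((∑' j : Fin d → ℕ,
        (ENNReal.ofReal ((2:ℝ) ^ (((∑ i, j i : ℕ) : ℝ) * s)) *
          (‖blockProj d f j x‖₊ : ℝ≥0∞)) ^ (2:ℕ)) ^ ((1:ℝ)/2)) ^ p.toReal) ^ (1 / p.toReal)

/-- Trigonometric polynomials with frequencies in `[-M,M]^d`. -/
def boxPoly (d M : ℕ) : Set ((Fin d → ℝ) → ℂ) :=
  {s | ∃ (Λ : Finset (Fin d → ℤ)) (a : (Fin d → ℤ) → ℂ),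
    (∀ k ∈ Λ, ∀ i, |k i| ≤ (M : ℤ)) ∧ s = fun x => ∑ k ∈ Λ, a k * expk d k x}

/-- Error of best approximation by trigonometric polynomials with
frequencies in `[-M,M]^d`, measured in `L_∞`. -/
def EBox (d M : ℕ) (f : (Fin d → ℝ) → ℂ) : ℝ≥0∞ :=
  ⨅ g ∈ boxPoly d M, LqNorm d ∞ (f - g)

/-- The `m`-th (non-linear) sampling width of the class of continuous functions
in the unit ball of `N`, error measured in `L_q`. -/
def samplingWidth (d m : ℕ) (N : ((Fin d → ℝ) → ℂ) → ℝ≥0∞) (q : ℝ≥0∞) : ℝ≥0∞ :=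
  ⨅ (t : Fin m → (Fin d → ℝ)) (_ : ∀ i, t i ∈ cube d)
    (R : (Fin m → ℂ) → ((Fin d → ℝ) → ℂ)),
    ⨆ f ∈ {f : (Fin d → ℝ) → ℂ | Continuous f ∧ N f ≤ 1},
      LqNorm d q (f - R fun i => f (t i))

/-- The one-dimensional character `x ↦ e^{2π i k x}`. -/
def char1 (k : ℤ) (x : ℝ) : ℂ := Complex.exp (((2 * Real.pi * ((k : ℝ) * x) : ℝ) : ℂ) * Complex.I)

/-- Lebesgue measure on `[0,1)`. -/
def unitVol : Measure ℝ := volume.restrict (Set.Ico (0:ℝ) 1)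

instance : IsProbabilityMeasure unitVol := ⟨by simp [unitVol]⟩

theorem norm_char1 (k : ℤ) (x : ℝ) : ‖char1 k x‖ = 1 := Complex.norm_exp_ofReal_mul_I _

theorem continuous_char1 (k : ℤ) : Continuous (char1 k) := by
  unfold char1; fun_prop

theorem char1_add (k l : ℤ) (x : ℝ) : char1 (k + l) x = char1 k x * char1 l x := by
  unfold char1; rw [← Complex.exp_add]; congr 1; push_cast; ring

theorem char1_zero (x : ℝ) : char1 0 x = 1 := by simp [char1]

theorem conj_char1 (k : ℤ) (x : ℝ) : (starRingEnd ℂ) (char1 k x) = char1 (-k) x := by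
  unfold char1; rw [← Complex.exp_conj]; congr 1
  simp [Complex.conj_ofReal, map_ofNat]

theorem integral_char1 (k : ℤ) : ∫ x, char1 k x ∂unitVol = if k = 0 then 1 else 0 := by
  unfold unitVol
  rw [integral_Ico_eq_integral_Ioo, ← integral_Ioc_eq_integral_Ioo,
    ← intervalIntegral.integral_of_le zero_le_one]
  split_ifs with h
  · subst h; simp [char1_zero]
  · have hk : ((2 * Real.pi * k * Complex.I : ℂ)) ≠ 0 := by
      simp [Real.pi_ne_zero, h, Complex.I_ne_zero]
    have : ∀ x : ℝ, char1 k x = Complex.exp ((2 * Real.pi * k * Complex.I) * x) := by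
      intro x; unfold char1; congr 1; push_cast; ring
    simp_rw [this]
    rw [integral_exp_mul_complex hk]
    have : Complex.exp (2 * Real.pi * k * Complex.I * ((1:ℝ):ℂ)) = 1 := by
      rw [Complex.exp_eq_one_iff]; exact ⟨k, by push_cast; ring⟩
    rw [this]; simp

theorem expk_eq_prod (d : ℕ) (k : Fin d → ℤ) (x : Fin d → ℝ) :
    expk d k x = ∏ i, char1 (k i) (x i) := by
  unfold expk char1
  rw [← Complex.exp_sum]
  congr 1
  push_cast
  rw [Finset.mul_sum, Finset.sum_mul]

theorem norm_expk (d : ℕ) (k : Fin d → ℤ) (x : Fin d → ℝ) : ‖expk d k x‖ = 1 :=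
  Complex.norm_exp_ofReal_mul_I _

theorem continuous_expk (d : ℕ) (k : Fin d → ℤ) : Continuous (expk d k) := by
  unfold expk; fun_prop

theorem volume_restrict_cube (d : ℕ) :
    (volume : Measure (Fin d → ℝ)).restrict (cube d) = Measure.pi fun _ => unitVol := by
  unfold cube unitVol
  rw [volume_pi, Measure.restrict_pi_pi]

instance (d : ℕ) : IsProbabilityMeasure ((volume : Measure (Fin d → ℝ)).restrict (cube d)) := by
  rw [volume_restrict_cube]; infer_instance

theorem expk_mul_neg (d : ℕ) (k l : Fin d → ℤ) (x : Fin d → ℝ) :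
    expk d k x * expk d (-l) x = expk d (k - l) x := by
  simp only [expk_eq_prod, ← Finset.prod_mul_distrib, ← char1_add]
  rfl

theorem conj_expk (d : ℕ) (k : Fin d → ℤ) (x : Fin d → ℝ) :
    (starRingEnd ℂ) (expk d k x) = expk d (-k) x := by
  simp [expk_eq_prod, conj_char1]

theorem integral_expk (d : ℕ) (k : Fin d → ℤ) :
    ∫ x in cube d, expk d k x = if k = 0 then 1 else 0 := by
  rw [volume_restrict_cube]
  simp_rw [expk_eq_prod]
  rw [integral_fintype_prod_eq_prod (μ := fun _ => unitVol) (fun i => char1 (k i))]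
  simp_rw [integral_char1]
  split_ifs with h
  · subst h; simp
  · obtain ⟨i, hi⟩ : ∃ i, k i ≠ 0 := by
      by_contra! hh; exact h (funext hh)
    exact Finset.prod_eq_zero (Finset.mem_univ i) (by simp [hi])

theorem integrable_expk (d : ℕ) (k : Fin d → ℤ) :
    Integrable (expk d k) (volume.restrict (cube d)) := by
  refine Integrable.of_bound (C := 1) (continuous_expk d k).aestronglyMeasurable ?_
  filter_upwards with x using (norm_expk d k x).le

theorem fCoeff_trig (d : ℕ) (Λ : Finset (Fin d → ℤ)) (a : (Fin d → ℤ) → ℂ) (k : Fin d → ℤ) :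
    fCoeff d (fun x => ∑ l ∈ Λ, a l * expk d l x) k = if k ∈ Λ then a k else 0 := by
  unfold fCoeff
  simp_rw [Finset.sum_mul, mul_assoc, expk_mul_neg]
  rw [integral_finsetSum _ fun _ _ => (integrable_expk d _).const_mul _]
  simp_rw [integral_const_mul, integral_expk, sub_eq_zero]
  simp

theorem integrable_trig (d : ℕ) (Λ : Finset (Fin d → ℤ)) (a : (Fin d → ℤ) → ℂ) :
    Integrable (fun x => ∑ l ∈ Λ, a l * expk d l x) (volume.restrict (cube d)) :=
  integrable_finsetSum _ fun _ _ => (integrable_expk d _).const_mul _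

theorem fCoeff_sub (d : ℕ) {f g : (Fin d → ℝ) → ℂ} (hf : IntegrableOn f (cube d))
    (hg : IntegrableOn g (cube d)) (k : Fin d → ℤ) :
    fCoeff d (f - g) k = fCoeff d f k - fCoeff d g k := by
  have hb : ∀ h : (Fin d → ℝ) → ℂ, IntegrableOn h (cube d) →
      Integrable (fun x => h x * expk d (-k) x) (volume.restrict (cube d)) := by
    intro h hh
    refine Integrable.mul_bdd (c := 1) hh (continuous_expk d _).aestronglyMeasurable ?_
    filter_upwards with x using (norm_expk d _ x).le
  unfold fCoeff
  rw [← integral_sub (hb f hf) (hb g hg)]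
  simp [sub_mul]

theorem bessel_scalar {X : Type*} [MeasurableSpace X] {μ : Measure X} [IsProbabilityMeasure μ]
    {ι : Type*} [DecidableEq ι] (e : ι → X → ℂ) (hm : ∀ k, AEStronglyMeasurable (e k) μ)
    (hb : ∀ k x, ‖e k x‖ ≤ 1)
    (ho : ∀ k l, ∫ x, (starRingEnd ℂ) (e k x) * e l x ∂μ = if k = l then 1 else 0)
    (S : Finset ι) {g : X → ℂ} (hg : MemLp g 2 μ) :
    ∑ k ∈ S, ‖∫ x, (starRingEnd ℂ) (e k x) * g x ∂μ‖ₑ ^ 2 ≤ ∫⁻ x, ‖g x‖ₑ ^ 2 ∂μ := by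
  have hmem : ∀ k, MemLp (e k) 2 μ := fun k =>
    MemLp.of_bound (hm k) 1 (Filter.Eventually.of_forall (hb k))
  set v : ι → Lp ℂ 2 μ := fun k => (hmem k).toLp (e k) with hv
  have hinner : ∀ k (f : X → ℂ) (hf : MemLp f 2 μ),
      inner ℂ (v k) (hf.toLp f) = ∫ x, (starRingEnd ℂ) (e k x) * f x ∂μ := by
    intro k f hf
    rw [MeasureTheory.L2.inner_def]
    refine integral_congr_ae ?_
    filter_upwards [(hmem k).coeFn_toLp, hf.coeFn_toLp] with x h1 h2
    simp only [hv]
    rw [h1, h2]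
    simp [mul_comm]
  have hon : Orthonormal ℂ v := by
    rw [orthonormal_iff_ite]
    intro k l
    rw [hinner k (e l) (hmem l), ho]
  have h := hon.sum_inner_products_le (x := hg.toLp g) (s := S)
  simp_rw [hinner] at h
  have h2 : ENNReal.ofReal (‖hg.toLp g‖ ^ 2) = ∫⁻ x, ‖g x‖ₑ ^ 2 ∂μ := by
    rw [Lp.norm_toLp, ENNReal.ofReal_pow ENNReal.toReal_nonneg, ENNReal.ofReal_toReal hg.2.ne,
      eLpNorm_eq_lintegral_rpow_enorm_toReal (by simp) (by simp)]
    simp only [ENNReal.toReal_ofNat, ENNReal.rpow_ofNat]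
    rw [← ENNReal.rpow_natCast, ← ENNReal.rpow_mul]
    norm_num
  rw [← h2]
  refine le_trans (le_of_eq ?_) (ENNReal.ofReal_le_ofReal h)
  rw [ENNReal.ofReal_sum_of_nonneg (fun _ _ => by positivity)]
  refine Finset.sum_congr rfl fun k _ => ?_
  rw [ENNReal.ofReal_pow (norm_nonneg _), ofReal_norm]

theorem enorm_sq_eq_sum {J : Type*} [Fintype J] (v : EuclideanSpace ℂ J) :
    ‖v‖ₑ ^ 2 = ∑ j, ‖v j‖ₑ ^ 2 := by
  rw [← ofReal_norm, ← ENNReal.ofReal_pow (norm_nonneg _), EuclideanSpace.norm_sq_eq,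
    ENNReal.ofReal_sum_of_nonneg (fun _ _ => by positivity)]
  refine Finset.sum_congr rfl fun k _ => ?_
  rw [ENNReal.ofReal_pow (norm_nonneg _), ofReal_norm]

/-- Bessel's inequality for bounded functions with values in a finite-dimensional Hilbert space. -/
theorem bessel_vector {X : Type*} [MeasurableSpace X] {μ : Measure X} [IsProbabilityMeasure μ]
    {ι : Type*} [DecidableEq ι] (e : ι → X → ℂ) (hm : ∀ k, AEStronglyMeasurable (e k) μ)
    (hb : ∀ k x, ‖e k x‖ ≤ 1)
    (ho : ∀ k l, ∫ x, (starRingEnd ℂ) (e k x) * e l x ∂μ = if k = l then 1 else 0)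
    (S : Finset ι) {J : Type*} [Fintype J] {g : X → EuclideanSpace ℂ J}
    (hgm : AEStronglyMeasurable g μ) {B : ℝ} (hgb : ∀ x, ‖g x‖ ≤ B) :
    ∑ k ∈ S, ‖∫ x, (starRingEnd ℂ) (e k x) • g x ∂μ‖ₑ ^ 2 ≤ ∫⁻ x, ‖g x‖ₑ ^ 2 ∂μ := by
  have hint : ∀ k, Integrable (fun x => (starRingEnd ℂ) (e k x) • g x) μ := by
    intro k
    refine Integrable.of_bound (C := B)
      ((RCLike.continuous_conj.comp_aestronglyMeasurable (hm k)).smul hgm) ?_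
    filter_upwards with x
    rw [norm_smul, RCLike.norm_conj]
    calc ‖e k x‖ * ‖g x‖ ≤ 1 * ‖g x‖ := by gcongr; exact hb k x
      _ ≤ B := by simpa using hgb x
  have hcoord : ∀ k j, (∫ x, (starRingEnd ℂ) (e k x) • g x ∂μ) j
      = ∫ x, (starRingEnd ℂ) (e k x) * g x j ∂μ := by
    intro k j
    have := (EuclideanSpace.proj (𝕜 := ℂ) j).integral_comp_comm (hint k)
    simpa using this.symm
  have hgj : ∀ j, AEStronglyMeasurable (fun x => g x j) μ := fun j =>
    (EuclideanSpace.proj (𝕜 := ℂ) j).continuous.comp_aestronglyMeasurable hgm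
  simp_rw [enorm_sq_eq_sum, hcoord]
  rw [Finset.sum_comm, lintegral_finsetSum' _ fun j _ => ((hgj j).enorm.pow_const 2)]
  refine Finset.sum_le_sum fun j _ => ?_
  refine bessel_scalar e hm hb ho S (MemLp.of_bound (hgj j) B ?_)
  filter_upwards with x
  exact (PiLp.norm_apply_le (g x) j).trans (hgb x)

theorem lintegral_Ioo_rpow {g s : ℝ} (hg : 0 ≤ g) (hs : -1 < s) :
    ∫⁻ t in Set.Ioi (0:ℝ), (if t < g then ENNReal.ofReal (t ^ s) else 0)
      = ENNReal.ofReal (g ^ (s + 1) / (s + 1)) := by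
  have h1 : (fun t : ℝ => if t < g then ENNReal.ofReal (t ^ s) else 0)
      = (Set.Iio g).indicator fun t => ENNReal.ofReal (t ^ s) := by
    ext t; simp [Set.indicator]
  rw [h1, lintegral_indicator measurableSet_Iio, Measure.restrict_restrict measurableSet_Iio,
    Set.Iio_inter_Ioi, restrict_Ioo_eq_restrict_Ioc,
    ← ofReal_integral_eq_lintegral_ofReal, ← intervalIntegral.integral_of_le hg,
    integral_rpow (Or.inl hs), Real.zero_rpow (by linarith), sub_zero]
  · exact (intervalIntegrable_iff_integrableOn_Ioc_of_le hg).1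
      (intervalIntegral.intervalIntegrable_rpow' hs)
  · filter_upwards [ae_restrict_mem measurableSet_Ioc] with t ht
    exact Real.rpow_nonneg ht.1.le _

theorem lintegral_Ici_rpow {g s : ℝ} (hg : 0 < g) (hs : s < -1) :
    ∫⁻ t in Set.Ioi (0:ℝ), (if g ≤ t then ENNReal.ofReal (t ^ s) else 0)
      = ENNReal.ofReal (- g ^ (s + 1) / (s + 1)) := by
  have h1 : (fun t : ℝ => if g ≤ t then ENNReal.ofReal (t ^ s) else 0)
      = (Set.Ici g).indicator fun t => ENNReal.ofReal (t ^ s) := by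
    ext t; simp [Set.indicator]
  have h2 : Set.Ici g ∩ Set.Ioi (0:ℝ) = Set.Ici g := by
    ext t; simp only [Set.mem_inter_iff, Set.mem_Ici, Set.mem_Ioi, and_iff_left_iff_imp]
    intro h; linarith
  rw [h1, lintegral_indicator measurableSet_Ici, Measure.restrict_restrict measurableSet_Ici,
    h2, ← restrict_Ioi_eq_restrict_Ici,
    ← ofReal_integral_eq_lintegral_ofReal, integral_Ioi_rpow_of_lt hs hg]
  · exact integrableOn_Ioi_rpow_of_lt hs hg
  · filter_upwards [ae_restrict_mem measurableSet_Ioi] with t ht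
    exact Real.rpow_nonneg (hg.le.trans ht.out.le) _

theorem sum_inv_sq_tail_nat (T : Finset ℕ) {t : ℝ} (ht : 0 < t) :
    ∑ n ∈ T, (if t < 1 + (n:ℝ) then ((1 + (n:ℝ)) ^ 2)⁻¹ else 0) ≤ 2 / t := by
  obtain ⟨M, hM⟩ := T.exists_nat_subset_range
  have h1 : ∑ n ∈ T, (if t < 1 + (n:ℝ) then ((1 + (n:ℝ)) ^ 2)⁻¹ else 0)
      ≤ ∑ i ∈ Finset.Ioo ⌊t⌋₊ (M + 1), ((i:ℝ) ^ 2)⁻¹ := by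
    rw [← Finset.sum_filter]
    have hinj : Set.InjOn (fun n : ℕ => n + 1) (T.filter fun n : ℕ => t < 1 + (n:ℝ)) :=
      fun a _ b _ h => by simpa using h
    calc ∑ n ∈ T.filter (fun n : ℕ => t < 1 + (n:ℝ)), ((1 + (n:ℝ)) ^ 2)⁻¹
        = ∑ i ∈ (T.filter (fun n : ℕ => t < 1 + (n:ℝ))).image (fun n : ℕ => n + 1), ((i:ℝ) ^ 2)⁻¹ := by
          rw [Finset.sum_image hinj]
          refine Finset.sum_congr rfl fun n _ => ?_
          push_cast; rw [add_comm]
      _ ≤ _ := by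
          refine Finset.sum_le_sum_of_subset_of_nonneg ?_ fun _ _ _ => by positivity
          intro i hi
          simp only [Finset.mem_image, Finset.mem_filter] at hi
          obtain ⟨n, ⟨hn, htn⟩, rfl⟩ := hi
          have := Finset.mem_range.1 (hM hn)
          rw [Finset.mem_Ioo]
          refine ⟨?_, by omega⟩
          rw [Nat.floor_lt ht.le]
          push_cast; linarith
  refine h1.trans ((sum_Ioo_inv_sq_le _ _).trans ?_)
  gcongr
  exact (Nat.lt_floor_add_one t).le

theorem sum_inv_sq_tail (S : Finset ℤ) {t : ℝ} (ht : 0 < t) :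
    ∑ k ∈ S, (if t < 1 + |(k:ℝ)| then ((1 + |(k:ℝ)|) ^ 2)⁻¹ else 0) ≤ 4 / t := by
  have key : ∀ S' : Finset ℤ, Set.InjOn Int.natAbs (S' : Set ℤ) →
      ∑ k ∈ S', (if t < 1 + |(k:ℝ)| then ((1 + |(k:ℝ)|) ^ 2)⁻¹ else 0) ≤ 2 / t := by
    intro S' hS'
    refine le_trans (le_of_eq ?_) (sum_inv_sq_tail_nat (S'.image Int.natAbs) ht)
    rw [Finset.sum_image hS']
    refine Finset.sum_congr rfl fun k _ => ?_
    rw [Nat.cast_natAbs, Int.cast_abs]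
  rw [← Finset.sum_filter_add_sum_filter_not S (fun k => 0 ≤ k)]
  have h1 := key (S.filter fun k => 0 ≤ k) (fun a ha b hb h => by
    simp only [Finset.coe_filter, Set.mem_ofPred_eq] at ha hb; omega)
  have h2 := key (S.filter fun k => ¬ 0 ≤ k) (fun a ha b hb h => by
    simp only [Finset.coe_filter, Set.mem_ofPred_eq] at ha hb; omega)
  calc _ ≤ 2 / t + 2 / t := add_le_add h1 h2
    _ = 4 / t := by ring

/-- The vector-valued trigonometric polynomial with coefficients `c k`, `k ∈ S`. -/
def vecTrig {J : Type*} [Fintype J] (S : Finset ℤ) (c : ℤ → EuclideanSpace ℂ J) (x : ℝ) :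
    EuclideanSpace ℂ J := ∑ k ∈ S, char1 k x • c k

section
variable {J : Type*} [Fintype J] (S : Finset ℤ) (c : ℤ → EuclideanSpace ℂ J)

theorem continuous_vecTrig : Continuous (vecTrig S c) := by
  unfold vecTrig
  exact continuous_finsetSum _ fun k _ => (continuous_char1 k).smul continuous_const

theorem norm_vecTrig_le (x : ℝ) : ‖vecTrig S c x‖ ≤ ∑ k ∈ S, ‖c k‖ := by
  refine (norm_sum_le _ _).trans (Finset.sum_le_sum fun k _ => ?_)
  rw [norm_smul, norm_char1, one_mul]

theorem char1_orthonormal (k l : ℤ) :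
    ∫ x, (starRingEnd ℂ) (char1 k x) * char1 l x ∂unitVol = if k = l then 1 else 0 := by
  simp_rw [conj_char1, ← char1_add, integral_char1]
  congr 1
  rw [eq_iff_iff]; omega

theorem integrable_bounded_vec {g : ℝ → EuclideanSpace ℂ J} (hg : Measurable g) {B : ℝ}
    (hB : ∀ x, ‖g x‖ ≤ B) (k : ℤ) :
    Integrable (fun x => (starRingEnd ℂ) (char1 k x) • g x) unitVol := by
  refine Integrable.of_bound (C := B) ?_ (Filter.Eventually.of_forall fun x => ?_)
  · exact ((RCLike.continuous_conj.comp (continuous_char1 k)).aestronglyMeasurable).smul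
      hg.aestronglyMeasurable
  · rw [norm_smul, RCLike.norm_conj, norm_char1, one_mul]; exact hB x

theorem coeff_vecTrig {k : ℤ} (hk : k ∈ S) :
    ∫ x, (starRingEnd ℂ) (char1 k x) • vecTrig S c x ∂unitVol = c k := by
  unfold vecTrig
  simp_rw [Finset.smul_sum, smul_smul]
  rw [integral_finsetSum]
  · simp_rw [integral_smul_const, char1_orthonormal]
    simp [hk]
  · intro l _
    refine Integrable.smul_const ?_ _
    refine Integrable.of_bound (C := 1) ?_ (Filter.Eventually.of_forall fun x => ?_)
    · exact ((RCLike.continuous_conj.comp (continuous_char1 k)).mul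
        (continuous_char1 l)).aestronglyMeasurable
    · rw [norm_mul, RCLike.norm_conj, norm_char1, norm_char1, one_mul]

theorem bessel_char1 {g : ℝ → EuclideanSpace ℂ J} (hg : Measurable g) {B : ℝ}
    (hB : ∀ x, ‖g x‖ ≤ B) :
    ∑ k ∈ S, ‖∫ x, (starRingEnd ℂ) (char1 k x) • g x ∂unitVol‖ₑ ^ 2
      ≤ ∫⁻ x, ‖g x‖ₑ ^ 2 ∂unitVol :=
  bessel_vector char1 (fun k => (continuous_char1 k).aestronglyMeasurable)
    (fun k x => (norm_char1 k x).le) char1_orthonormal S hg.aestronglyMeasurable hB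

/-- Weak-type estimate at a fixed level. -/
theorem weak_level {t : ℝ} (ht : 0 < t) :
    ∑ k ∈ S, (if t < (1 + |(k:ℝ)|) * ‖c k‖ then
        ENNReal.ofReal (((1 + |(k:ℝ)|) ^ 2)⁻¹) else 0)
      ≤ ENNReal.ofReal (8 / t) *
          ∫⁻ x, (if t < ‖vecTrig S c x‖ then ‖vecTrig S c x‖ₑ else 0) ∂unitVol
        + ENNReal.ofReal (4 / t ^ 2) *
          ∫⁻ x, (if ‖vecTrig S c x‖ ≤ t then ‖vecTrig S c x‖ₑ ^ 2 else 0) ∂unitVol := by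
  set G := vecTrig S c with hG
  have hGm : Measurable G := (continuous_vecTrig S c).measurable
  have hGb := norm_vecTrig_le S c
  set B := ∑ k ∈ S, ‖c k‖ with hBdef
  have hB0 : 0 ≤ B := Finset.sum_nonneg fun _ _ => norm_nonneg _
  set A : Set ℝ := {x | t < ‖G x‖} with hA
  have hAm : MeasurableSet A := measurableSet_lt measurable_const hGm.norm
  set G1 := A.indicator G
  set G2 := Aᶜ.indicator G
  have hG1m : Measurable G1 := hGm.indicator hAm
  have hG2m : Measurable G2 := hGm.indicator hAm.compl
  have hG1b : ∀ x, ‖G1 x‖ ≤ B := fun x => (norm_indicator_le_norm_self _ _).trans (hGb x)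
  have hG2b : ∀ x, ‖G2 x‖ ≤ B := fun x => (norm_indicator_le_norm_self _ _).trans (hGb x)
  set b : ℤ → EuclideanSpace ℂ J := fun k => ∫ x, (starRingEnd ℂ) (char1 k x) • G1 x ∂unitVol
  set s : ℤ → EuclideanSpace ℂ J := fun k => ∫ x, (starRingEnd ℂ) (char1 k x) • G2 x ∂unitVol
  have hsum : ∀ k ∈ S, c k = b k + s k := by
    intro k hk
    rw [← coeff_vecTrig S c hk, ← integral_add (integrable_bounded_vec hG1m hG1b k)
      (integrable_bounded_vec hG2m hG2b k)]
    refine integral_congr_ae (Filter.Eventually.of_forall fun x => ?_)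
    simp only [← smul_add]
    congr 1
    exact (congrFun (Set.indicator_self_add_compl A G) x).symm
  set U := ∫ x, ‖G1 x‖ ∂unitVol with hU
  have hG1int : Integrable G1 unitVol :=
    Integrable.of_bound (C := B) hG1m.aestronglyMeasurable (Filter.Eventually.of_forall hG1b)
  have hU0 : 0 ≤ U := integral_nonneg fun _ => norm_nonneg _
  have hbU : ∀ k, ‖b k‖ ≤ U := by
    intro k
    refine (norm_integral_le_integral_norm _).trans (le_of_eq ?_)
    refine integral_congr_ae (Filter.Eventually.of_forall fun x => ?_)
    simp only [norm_smul, RCLike.norm_conj, norm_char1, one_mul]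
  have hUe : ENNReal.ofReal U = ∫⁻ x, (if t < ‖G x‖ then ‖G x‖ₑ else 0) ∂unitVol := by
    rw [hU, ofReal_integral_norm_eq_lintegral_enorm hG1int]
    refine lintegral_congr fun x => ?_
    by_cases hx : t < ‖G x‖
    · have : x ∈ A := hx
      simp [G1, this, hx]
    · have : x ∉ A := hx
      simp [G1, this, hx]
  have hV : ∑ k ∈ S, ‖s k‖ₑ ^ 2 ≤ ∫⁻ x, (if ‖G x‖ ≤ t then ‖G x‖ₑ ^ 2 else 0) ∂unitVol := by
    refine (bessel_char1 S hG2m hG2b).trans (le_of_eq (lintegral_congr fun x => ?_))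
    by_cases hx : ‖G x‖ ≤ t
    · have : x ∈ Aᶜ := not_lt.2 hx
      simp only [G2, Set.indicator_of_mem this, if_pos hx]
    · have : x ∉ Aᶜ := fun h => hx (not_lt.1 h)
      simp only [G2, Set.indicator_of_notMem this, if_neg hx]
      simp
  have hpt : ∀ k ∈ S, (if t < (1 + |(k:ℝ)|) * ‖c k‖ then
        ENNReal.ofReal (((1 + |(k:ℝ)|) ^ 2)⁻¹) else 0)
      ≤ ENNReal.ofReal (if t / 2 < (1 + |(k:ℝ)|) * U then ((1 + |(k:ℝ)|) ^ 2)⁻¹ else 0)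
        + ENNReal.ofReal (4 / t ^ 2) * ‖s k‖ₑ ^ 2 := by
    intro k hk
    have hw : 0 < 1 + |(k:ℝ)| := by positivity
    split_ifs with h1 h2
    · exact le_self_add
    · refine le_add_left ?_
      have h3 : ‖c k‖ ≤ U + ‖s k‖ := by
        rw [hsum k hk]; exact (norm_add_le _ _).trans (by gcongr; exact hbU k)
      have h4 : t / 2 < (1 + |(k:ℝ)|) * ‖s k‖ := by nlinarith
      rw [← ofReal_norm, ← ENNReal.ofReal_pow (norm_nonneg _),
        ← ENNReal.ofReal_mul (by positivity)]
      refine ENNReal.ofReal_le_ofReal ?_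
      have h5 : (t / 2) ^ 2 ≤ ((1 + |(k:ℝ)|) * ‖s k‖) ^ 2 := by gcongr
      rw [inv_le_iff_one_le_mul₀ (by positivity)]
      have : 4 / t ^ 2 * ‖s k‖ ^ 2 * (1 + |(k:ℝ)|) ^ 2
        = ((1 + |(k:ℝ)|) * ‖s k‖) ^ 2 / (t / 2) ^ 2 := by field_simp; ring
      rw [this, one_le_div (by positivity)]
      exact h5
    · exact zero_le
    · exact zero_le
  refine (Finset.sum_le_sum hpt).trans ?_
  rw [Finset.sum_add_distrib, ← Finset.mul_sum]
  refine add_le_add ?_ (by gcongr)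
  rw [← hUe, ← ENNReal.ofReal_mul (by positivity),
    ← ENNReal.ofReal_sum_of_nonneg (fun k _ => by split_ifs <;> positivity)]
  refine ENNReal.ofReal_le_ofReal ?_
  rcases hU0.eq_or_lt with hU00 | hUpos
  · rw [← hU00]
    simp [not_lt.2 (show (0:ℝ) ≤ t / 2 by positivity)]
  · have := sum_inv_sq_tail S (t := t / (2 * U)) (by positivity)
    have h6 : 4 / (t / (2 * U)) = 8 / t * U := by field_simp; ring
    rw [h6] at this
    refine le_trans (le_of_eq ?_) this
    refine Finset.sum_congr rfl fun k _ => ?_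
    congr 1
    rw [eq_iff_iff, div_lt_iff₀ (by positivity : 0 < 2 * U), div_lt_iff₀ two_pos]
    constructor <;> intro h <;> linarith

end

theorem measurable_rpow_ite_lt (s : ℝ) :
    Measurable fun z : ℝ × ℝ => if z.1 < z.2 then ENNReal.ofReal (z.1 ^ s) else 0 :=
  Measurable.ite (measurableSet_lt measurable_fst measurable_snd) (by fun_prop) measurable_const

theorem measurable_rpow_ite_le (s : ℝ) :
    Measurable fun z : ℝ × ℝ => if z.2 ≤ z.1 then ENNReal.ofReal (z.1 ^ s) else 0 :=
  Measurable.ite (measurableSet_le measurable_snd measurable_fst) (by fun_prop) measurable_const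

/-- The Hardy–Littlewood inequality for vector-valued trigonometric polynomials, `1 < p < 2`. -/
theorem paley_one_lt {p : ℝ} (hp1 : 1 < p) (hp2 : p < 2) {J : Type*} [Fintype J]
    (S : Finset ℤ) (c : ℤ → EuclideanSpace ℂ J) :
    ∑ k ∈ S, ENNReal.ofReal ((1 + |(k:ℝ)|) ^ (p - 2)) * ‖c k‖ₑ ^ p
      ≤ ENNReal.ofReal (p * (8 / (p - 1) + 4 / (2 - p))) *
        ∫⁻ x, ‖vecTrig S c x‖ₑ ^ p ∂unitVol := by
  set G := vecTrig S c with hG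
  have hGm : Measurable G := (continuous_vecTrig S c).measurable
  have hgm : Measurable fun x => ‖G x‖ := hGm.norm
  have henorm : ∀ v : EuclideanSpace ℂ J, ‖v‖ₑ ^ p = ENNReal.ofReal (‖v‖ ^ p) := fun v => by
    rw [← ofReal_norm, ENNReal.ofReal_rpow_of_nonneg (norm_nonneg _) (by linarith)]
  -- layer-cake representation of the left-hand side
  have hL : ∀ k : ℤ, ENNReal.ofReal ((1 + |(k:ℝ)|) ^ (p - 2)) * ‖c k‖ₑ ^ p
      = ENNReal.ofReal p * ∫⁻ t in Set.Ioi (0:ℝ), ENNReal.ofReal (t ^ (p - 1)) *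
        (if t < (1 + |(k:ℝ)|) * ‖c k‖ then ENNReal.ofReal (((1 + |(k:ℝ)|) ^ 2)⁻¹) else 0) := by
    intro k
    have hw : 0 < 1 + |(k:ℝ)| := by positivity
    have h1 : ∀ t : ℝ, ENNReal.ofReal (t ^ (p - 1)) *
        (if t < (1 + |(k:ℝ)|) * ‖c k‖ then ENNReal.ofReal (((1 + |(k:ℝ)|) ^ 2)⁻¹) else 0)
        = ENNReal.ofReal (((1 + |(k:ℝ)|) ^ 2)⁻¹) *
          (if t < (1 + |(k:ℝ)|) * ‖c k‖ then ENNReal.ofReal (t ^ (p - 1)) else 0) := by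
      intro t; split_ifs <;> simp [mul_comm]
    simp_rw [h1]
    rw [lintegral_const_mul' _ _ ENNReal.ofReal_ne_top,
      lintegral_Ioo_rpow (by positivity) (by linarith), henorm,
      ← ENNReal.ofReal_mul (by positivity), ← ENNReal.ofReal_mul (by positivity),
      ← ENNReal.ofReal_mul (by positivity)]
    congr 1
    rw [sub_add_cancel, Real.mul_rpow hw.le (norm_nonneg _), Real.rpow_sub hw, Real.rpow_two]
    field_simp
  have hT1 : ∫⁻ t in Set.Ioi (0:ℝ), ENNReal.ofReal (t ^ (p - 2)) *
        ∫⁻ x, (if t < ‖G x‖ then ‖G x‖ₑ else 0) ∂unitVol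
      = ENNReal.ofReal (1 / (p - 1)) * ∫⁻ x, ‖G x‖ₑ ^ p ∂unitVol := by
    calc _ = ∫⁻ t in Set.Ioi (0:ℝ), ∫⁻ x,
          (if t < ‖G x‖ then ENNReal.ofReal (t ^ (p - 2)) else 0) * ‖G x‖ₑ ∂unitVol := by
          refine lintegral_congr fun t => ?_
          rw [← lintegral_const_mul' _ _ ENNReal.ofReal_ne_top]
          refine lintegral_congr fun x => ?_
          split_ifs <;> simp
      _ = ∫⁻ x, (∫⁻ t in Set.Ioi (0:ℝ),
          (if t < ‖G x‖ then ENNReal.ofReal (t ^ (p - 2)) else 0) * ‖G x‖ₑ) ∂unitVol := by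
          refine lintegral_lintegral_swap (Measurable.aemeasurable ?_)
          exact ((measurable_rpow_ite_lt (p - 2)).comp
            (measurable_fst.prodMk (hgm.comp measurable_snd))).mul (hGm.enorm.comp measurable_snd)
      _ = ∫⁻ x, ENNReal.ofReal (1 / (p - 1)) * ‖G x‖ₑ ^ p ∂unitVol := by
          refine lintegral_congr fun x => ?_
          rw [lintegral_mul_const' _ _ enorm_ne_top,
            lintegral_Ioo_rpow (norm_nonneg _) (by linarith), henorm, ← ofReal_norm,
            ← ENNReal.ofReal_mul (by have : 0 < p - 2 + 1 := by linarith
                                     positivity),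
            ← ENNReal.ofReal_mul (by have : 0 < p - 1 := by linarith
                                     positivity)]
          congr 1
          rw [show p - 2 + 1 = p - 1 by ring, div_mul_eq_mul_div, ← Real.rpow_add_one' (norm_nonneg _)
            (by linarith), sub_add_cancel]
          ring
      _ = _ := lintegral_const_mul' _ _ ENNReal.ofReal_ne_top
  have hT2 : ∫⁻ t in Set.Ioi (0:ℝ), ENNReal.ofReal (t ^ (p - 3)) *
        ∫⁻ x, (if ‖G x‖ ≤ t then ‖G x‖ₑ ^ 2 else 0) ∂unitVol
      ≤ ENNReal.ofReal (1 / (2 - p)) * ∫⁻ x, ‖G x‖ₑ ^ p ∂unitVol := by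
    calc _ = ∫⁻ t in Set.Ioi (0:ℝ), ∫⁻ x,
          (if ‖G x‖ ≤ t then ENNReal.ofReal (t ^ (p - 3)) else 0) * ‖G x‖ₑ ^ 2 ∂unitVol := by
          refine lintegral_congr fun t => ?_
          rw [← lintegral_const_mul' _ _ ENNReal.ofReal_ne_top]
          refine lintegral_congr fun x => ?_
          split_ifs <;> simp
      _ = ∫⁻ x, (∫⁻ t in Set.Ioi (0:ℝ),
          (if ‖G x‖ ≤ t then ENNReal.ofReal (t ^ (p - 3)) else 0) * ‖G x‖ₑ ^ 2) ∂unitVol := by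
          refine lintegral_lintegral_swap (Measurable.aemeasurable ?_)
          exact ((measurable_rpow_ite_le (p - 3)).comp
            (measurable_fst.prodMk (hgm.comp measurable_snd))).mul
              ((hGm.enorm.comp measurable_snd).pow_const 2)
      _ ≤ ∫⁻ x, ENNReal.ofReal (1 / (2 - p)) * ‖G x‖ₑ ^ p ∂unitVol := by
          refine lintegral_mono fun x => ?_
          rw [lintegral_mul_const' _ _ (by simp)]
          rcases (norm_nonneg (G x)).eq_or_lt with h0 | h0
          · have : ‖G x‖ₑ = 0 := by rw [← ofReal_norm, ← h0]; simp
            simp [this]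
          · rw [lintegral_Ici_rpow h0 (by linarith), henorm, ← ofReal_norm,
              ← ENNReal.ofReal_pow (norm_nonneg _), ← ENNReal.ofReal_mul' (by positivity),
              ← ENNReal.ofReal_mul (by have : 0 < 2 - p := by linarith
                                       positivity)]
            refine le_of_eq ?_
            congr 1
            rw [show p - 3 + 1 = p - 2 by ring, Real.rpow_sub h0, Real.rpow_two]
            have : p - 2 ≠ 0 := by linarith
            have : 2 - p ≠ 0 := by linarith
            field_simp
            ring
      _ = _ := lintegral_const_mul' _ _ ENNReal.ofReal_ne_top
  have hmeas1 : Measurable fun t : ℝ => ∫⁻ x, (if t < ‖G x‖ then ‖G x‖ₑ else 0) ∂unitVol := by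
    refine Measurable.lintegral_prod_right ?_
    exact Measurable.ite (measurableSet_lt measurable_fst (hgm.comp measurable_snd))
      (hGm.enorm.comp measurable_snd) measurable_const
  simp_rw [hL]
  rw [← Finset.mul_sum, ← lintegral_finsetSum' _ fun k _ => by
    refine (Measurable.mul (by fun_prop) (Measurable.ite ?_ measurable_const
      measurable_const)).aemeasurable
    exact measurableSet_lt measurable_id measurable_const]
  calc _ ≤ ENNReal.ofReal p * ∫⁻ t in Set.Ioi (0:ℝ),
        (ENNReal.ofReal 8 * (ENNReal.ofReal (t ^ (p - 2)) *
          ∫⁻ x, (if t < ‖G x‖ then ‖G x‖ₑ else 0) ∂unitVol)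
        + ENNReal.ofReal 4 * (ENNReal.ofReal (t ^ (p - 3)) *
          ∫⁻ x, (if ‖G x‖ ≤ t then ‖G x‖ₑ ^ 2 else 0) ∂unitVol)) := by
        gcongr ENNReal.ofReal p * ?_
        refine setLIntegral_mono' measurableSet_Ioi fun t ht => ?_
        have ht : 0 < t := ht
        rw [← Finset.mul_sum]
        refine (mul_le_mul_right (weak_level S c ht) _).trans (le_of_eq ?_)
        rw [mul_add]
        simp only [← mul_assoc]
        have hp3 : t ^ (p - 2) = t ^ (p - 1) / t := by
          rw [show p - 2 = p - 1 - 1 by ring, Real.rpow_sub_one ht.ne']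
        have hp4 : t ^ (p - 3) = t ^ (p - 1) / t ^ 2 := by
          rw [show p - 3 = p - 1 - 2 by ring, Real.rpow_sub ht, Real.rpow_two]
        congr 2
        · rw [← ENNReal.ofReal_mul (by positivity), ← ENNReal.ofReal_mul (by positivity), hp3]
          congr 1; ring
        · rw [← ENNReal.ofReal_mul (by positivity), ← ENNReal.ofReal_mul (by positivity), hp4]
          congr 1; ring
    _ = ENNReal.ofReal p * (ENNReal.ofReal 8 * (∫⁻ t in Set.Ioi (0:ℝ), ENNReal.ofReal (t ^ (p - 2)) *
          ∫⁻ x, (if t < ‖G x‖ then ‖G x‖ₑ else 0) ∂unitVol)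
        + ENNReal.ofReal 4 * ∫⁻ t in Set.Ioi (0:ℝ), (ENNReal.ofReal (t ^ (p - 3)) *
          ∫⁻ x, (if ‖G x‖ ≤ t then ‖G x‖ₑ ^ 2 else 0) ∂unitVol)) := by
        rw [lintegral_add_left, lintegral_const_mul' _ _ ENNReal.ofReal_ne_top,
          lintegral_const_mul' _ _ ENNReal.ofReal_ne_top]
        exact (Measurable.mul (by fun_prop) hmeas1).const_mul _
    _ ≤ ENNReal.ofReal p * (ENNReal.ofReal 8 * (ENNReal.ofReal (1 / (p - 1)) *
          ∫⁻ x, ‖G x‖ₑ ^ p ∂unitVol)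
        + ENNReal.ofReal 4 * (ENNReal.ofReal (1 / (2 - p)) * ∫⁻ x, ‖G x‖ₑ ^ p ∂unitVol)) := by
        rw [hT1]; gcongr
    _ = _ := by
        have h1 : 0 < p - 1 := by linarith
        have h2 : 0 < 2 - p := by linarith
        rw [ENNReal.ofReal_mul (by linarith), ENNReal.ofReal_add (by positivity) (by positivity),
          ← mul_assoc (ENNReal.ofReal 8), ← mul_assoc (ENNReal.ofReal 4), ← add_mul,
          ← ENNReal.ofReal_mul (by norm_num), ← ENNReal.ofReal_mul (by norm_num), mul_one_div,
          mul_one_div, mul_assoc]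

theorem paley_one {p : ℝ} (hp1 : 1 < p) (hp2 : p ≤ 2) :
    ∃ C : ℝ, 0 < C ∧ ∀ (J : Type) [Fintype J] (S : Finset ℤ) (c : ℤ → EuclideanSpace ℂ J),
      ∑ k ∈ S, ENNReal.ofReal ((1 + |(k:ℝ)|) ^ (p - 2)) * ‖c k‖ₑ ^ p
        ≤ ENNReal.ofReal C * ∫⁻ x, ‖vecTrig S c x‖ₑ ^ p ∂unitVol := by
  rcases hp2.eq_or_lt with rfl | hp2
  · refine ⟨1, one_pos, fun J _ S c => ?_⟩
    have := bessel_char1 S (continuous_vecTrig S c).measurable (norm_vecTrig_le S c)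
    rw [Finset.sum_congr rfl fun k hk => by rw [coeff_vecTrig S c hk]] at this
    simpa using this
  · have h1 : 0 < p - 1 := by linarith
    have h2 : 0 < 2 - p := by linarith
    exact ⟨_, by positivity, fun J _ S c => paley_one_lt hp1 hp2 S c⟩

/-- The `d`-variate vector-valued trigonometric polynomial with coefficients `c k`, `k ∈ S ^ d`. -/
def vecTrigMulti (d : ℕ) {J : Type*} [Fintype J] (S : Finset ℤ)
    (c : (Fin d → ℤ) → EuclideanSpace ℂ J) (x : Fin d → ℝ) : EuclideanSpace ℂ J :=
  ∑ k ∈ Fintype.piFinset (fun _ : Fin d => S), expk d k x • c k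

theorem continuous_vecTrigMulti (d : ℕ) {J : Type*} [Fintype J] (S : Finset ℤ)
    (c : (Fin d → ℤ) → EuclideanSpace ℂ J) : Continuous (vecTrigMulti d S c) := by
  unfold vecTrigMulti
  exact continuous_finsetSum _ fun k _ => (continuous_expk d k).smul continuous_const

theorem sum_piFinset_succ {M α : Type*} [AddCommMonoid M] [DecidableEq α] {d : ℕ}
    (S : Fin (d + 1) → Finset α) (F : (Fin (d + 1) → α) → M) :
    ∑ k ∈ Fintype.piFinset S, F k
      = ∑ a ∈ S 0, ∑ k ∈ Fintype.piFinset (fun i : Fin d => S i.succ), F (Fin.cons a k) := by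
  rw [← Finset.sum_product']
  refine Finset.sum_nbij' (fun k => (k 0, Fin.tail k)) (fun z => Fin.cons z.1 z.2) ?_ ?_ ?_ ?_ ?_
  · intro k hk
    rw [Fintype.mem_piFinset] at hk
    simp only [Finset.mem_product, Fintype.mem_piFinset]
    exact ⟨hk 0, fun i => hk i.succ⟩
  · rintro ⟨a, k⟩ hk
    simp only [Finset.mem_product, Fintype.mem_piFinset] at hk ⊢
    exact fun i => Fin.cases hk.1 hk.2 i
  · intro k _; exact Fin.cons_self_tail k
  · rintro ⟨a, k⟩ _; simp
  · intro k _; simp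

theorem lintegral_pi_succ {d : ℕ} {h : (Fin (d + 1) → ℝ) → ℝ≥0∞} (hh : Measurable h) :
    ∫⁻ x, h x ∂(Measure.pi fun _ : Fin (d + 1) => unitVol)
      = ∫⁻ x', (∫⁻ x0, h (Fin.cons x0 x') ∂unitVol) ∂(Measure.pi fun _ : Fin d => unitVol) := by
  have hmp := (measurePreserving_piFinSuccAbove (fun _ : Fin (d + 1) => unitVol) 0).symm
  rw [← hmp.lintegral_comp hh, lintegral_prod_symm]
  · simp [MeasurableEquiv.piFinSuccAbove, Fin.insertNthEquiv, Fin.insertNth_zero']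
  · exact (hh.comp (MeasurableEquiv.measurable _)).aemeasurable

theorem expk_cons (d : ℕ) (a : ℤ) (k : Fin d → ℤ) (t : ℝ) (x : Fin d → ℝ) :
    expk (d + 1) (Fin.cons a k) (Fin.cons t x) = char1 a t * expk d k x := by
  simp [expk_eq_prod, Fin.prod_univ_succ]

theorem wt_cons (d : ℕ) (a : ℤ) (k : Fin d → ℤ) :
    wt (d + 1) (Fin.cons a k) = (1 + |(a:ℝ)|) * wt d k := by
  simp [wt, Fin.prod_univ_succ]

theorem wt_pos (d : ℕ) (k : Fin d → ℤ) : 0 < wt d k :=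
  Finset.prod_pos fun _ _ => by positivity

theorem paley_multi {p C : ℝ}
    (hC : ∀ (J : Type) [Fintype J] (S : Finset ℤ) (c : ℤ → EuclideanSpace ℂ J),
      ∑ k ∈ S, ENNReal.ofReal ((1 + |(k:ℝ)|) ^ (p - 2)) * ‖c k‖ₑ ^ p
        ≤ ENNReal.ofReal C * ∫⁻ x, ‖vecTrig S c x‖ₑ ^ p ∂unitVol)
    (J : Type) [Fintype J] (S : Finset ℤ) (d : ℕ) (c : (Fin d → ℤ) → EuclideanSpace ℂ J) :
    ∑ k ∈ Fintype.piFinset (fun _ : Fin d => S), ENNReal.ofReal (wt d k ^ (p - 2)) * ‖c k‖ₑ ^ p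
      ≤ ENNReal.ofReal C ^ d *
        ∫⁻ x, ‖vecTrigMulti d S c x‖ₑ ^ p ∂(Measure.pi fun _ : Fin d => unitVol) := by
  induction d with
  | zero =>
    have hx : ∀ x : Fin 0 → ℝ, vecTrigMulti 0 S c x = c default := by
      intro x
      simp [vecTrigMulti, expk]
      congr 1
      exact Subsingleton.elim _ _
    simp_rw [hx]
    simp only [Finset.univ_eq_empty, wt, Finset.prod_empty, Real.one_rpow, ENNReal.ofReal_one,
      one_mul, pow_zero, lintegral_const, measure_univ, mul_one]
    rw [Fintype.piFinset_of_isEmpty, Fintype.sum_unique]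
    rw [Subsingleton.elim (@default (Fin 0 → ℤ) Unique.instInhabited)
      (@default (Fin 0 → ℤ) Pi.instInhabited)]
  | succ d ih =>
    rw [sum_piFinset_succ, lintegral_pi_succ
      ((continuous_vecTrigMulti _ S c).measurable.enorm.pow_const p)]
    set G : ℤ → (Fin d → ℝ) → EuclideanSpace ℂ J := fun a =>
      vecTrigMulti d S fun k => c (Fin.cons a k) with hG
    have hGx : ∀ x' x0, vecTrigMulti (d + 1) S c (Fin.cons x0 x')
        = vecTrig S (fun a => G a x') x0 := by
      intro x' x0
      unfold vecTrigMulti vecTrig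
      rw [sum_piFinset_succ]
      refine Finset.sum_congr rfl fun a _ => ?_
      simp only [hG, vecTrigMulti, Finset.smul_sum, smul_smul, expk_cons]
    have hGm : ∀ a, Measurable fun x' => ‖G a x'‖ₑ ^ p := fun a =>
      (continuous_vecTrigMulti d S fun k => c (Fin.cons a k)).measurable.enorm.pow_const p
    calc _ = ∑ a ∈ S, ENNReal.ofReal ((1 + |(a:ℝ)|) ^ (p - 2)) *
            ∑ k ∈ Fintype.piFinset (fun _ : Fin d => S), ENNReal.ofReal (wt d k ^ (p - 2)) *
              ‖c (Fin.cons a k)‖ₑ ^ p := by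
          refine Finset.sum_congr rfl fun a _ => ?_
          rw [Finset.mul_sum]
          refine Finset.sum_congr rfl fun k _ => ?_
          rw [wt_cons, Real.mul_rpow (by positivity) (wt_pos d k).le,
            ENNReal.ofReal_mul (by positivity), mul_assoc]
      _ ≤ ∑ a ∈ S, ENNReal.ofReal ((1 + |(a:ℝ)|) ^ (p - 2)) * (ENNReal.ofReal C ^ d *
            ∫⁻ x', ‖G a x'‖ₑ ^ p ∂(Measure.pi fun _ : Fin d => unitVol)) := by
          gcongr with a _
          exact ih _
      _ = ENNReal.ofReal C ^ d * ∫⁻ x', (∑ a ∈ S, ENNReal.ofReal ((1 + |(a:ℝ)|) ^ (p - 2)) *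
            ‖G a x'‖ₑ ^ p) ∂(Measure.pi fun _ : Fin d => unitVol) := by
          rw [lintegral_finsetSum _ fun a _ => (hGm a).const_mul _, Finset.mul_sum]
          refine Finset.sum_congr rfl fun a _ => ?_
          rw [lintegral_const_mul _ (hGm a), mul_left_comm]
      _ ≤ ENNReal.ofReal C ^ d * ∫⁻ x', (ENNReal.ofReal C *
            ∫⁻ x0, ‖vecTrig S (fun a => G a x') x0‖ₑ ^ p ∂unitVol)
              ∂(Measure.pi fun _ : Fin d => unitVol) := by
          gcongr with x'
          exact hC J S _
      _ = _ := by
          rw [lintegral_const_mul' _ _ ENNReal.ofReal_ne_top, ← mul_assoc, ← pow_succ]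
          simp_rw [hGx]

/-- The multi-index of the dyadic block containing `k`. -/
def blockIdx {d : ℕ} (k : Fin d → ℤ) : Fin d → ℕ := fun i => (k i).natAbs.size

/-- The size `2 ^ ‖j‖₁` of the dyadic block `I_j` containing `k`. -/
def blockSize {d : ℕ} (k : Fin d → ℤ) : ℝ := 2 ^ (∑ i, blockIdx k i)

theorem mem_blockF {n : ℕ} {k : ℤ} : k ∈ blockF n ↔ k.natAbs.size = n := by
  have habs : |k| = (k.natAbs : ℤ) := Int.abs_eq_natAbs k
  unfold blockF
  rw [Finset.mem_filter, Finset.mem_Icc, ← abs_le, habs]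
  rcases Nat.eq_zero_or_pos n with rfl | hn
  · simp only [Nat.size_eq_zero, Int.natAbs_eq_zero, pow_zero]
    constructor
    · rintro ⟨-, ⟨-, h⟩ | ⟨h, -⟩⟩
      exacts [h, absurd rfl h]
    · rintro rfl
      simp
  · obtain ⟨m, rfl⟩ := Nat.exists_eq_succ_of_ne_zero hn.ne'
    simp only [Nat.succ_eq_add_one, Nat.add_one_ne_zero, false_and, ne_eq, not_false_eq_true,
      true_and, false_or, Nat.add_sub_cancel]
    have h1 : ((2:ℤ) ^ m ≤ k.natAbs) ↔ m < k.natAbs.size := by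
      rw [Nat.lt_size]; exact_mod_cast Iff.rfl
    have h2 : ((k.natAbs : ℤ) < (2:ℤ) ^ (m + 1)) ↔ k.natAbs.size ≤ m + 1 := by
      rw [Nat.size_le]; exact_mod_cast Iff.rfl
    rw [h1, h2]
    constructor
    · rintro ⟨-, h3, h4⟩; omega
    · intro h
      exact ⟨(h2.2 h.le).le, by omega, by omega⟩

theorem mem_piFinset_blockF {d : ℕ} {j : Fin d → ℕ} {k : Fin d → ℤ} :
    k ∈ Fintype.piFinset (fun i => blockF (j i)) ↔ blockIdx k = j := by
  rw [Fintype.mem_piFinset, funext_iff]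
  exact forall_congr' fun i => mem_blockF

theorem blockSize_pos {d : ℕ} (k : Fin d → ℤ) : 0 < blockSize k := by
  unfold blockSize; positivity

theorem wt_le_blockSize {d : ℕ} (k : Fin d → ℤ) : wt d k ≤ blockSize k := by
  unfold wt blockSize blockIdx
  rw [← Finset.prod_pow_eq_pow_sum]
  refine Finset.prod_le_prod (fun _ _ => by positivity) fun i _ => ?_
  have := Nat.lt_size_self (k i).natAbs
  have h2 : (1 + (k i).natAbs : ℝ) ≤ 2 ^ (k i).natAbs.size := by
    rw [add_comm]; exact_mod_cast this
  rwa [Nat.cast_natAbs, Int.cast_abs] at h2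

theorem vecTrigMulti_block {d n : ℕ} (a : (Fin d → ℤ) → ℂ) (s : ℝ)
    (x : Fin d → ℝ) (j : Fin d → ℕ) (hj : ∀ i, j i ≤ n) :
    ∑ k ∈ Fintype.piFinset (fun _ : Fin d => Finset.Ioo (-(2:ℤ) ^ n) (2 ^ n)),
      expk d k x * (if blockIdx k = j then ((blockSize k ^ s : ℝ) : ℂ) * a k else 0)
    = (((2:ℝ) ^ (((∑ i, j i : ℕ) : ℝ) * s) : ℝ) : ℂ) *
        ∑ k ∈ Fintype.piFinset (fun i => blockF (j i)), a k * expk d k x := by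
  have hsub : Fintype.piFinset (fun i => blockF (j i)) ⊆
      Fintype.piFinset (fun _ : Fin d => Finset.Ioo (-(2:ℤ) ^ n) (2 ^ n)) := by
    refine Fintype.piFinset_subset _ _ fun i k hk => ?_
    rw [mem_blockF] at hk
    rw [Finset.mem_Ioo, ← abs_lt, Int.abs_eq_natAbs]
    exact_mod_cast Nat.size_le.1 (hk.le.trans (hj i))
  rw [← Finset.sum_subset hsub, Finset.mul_sum]
  · refine Finset.sum_congr rfl fun k hk => ?_
    rw [mem_piFinset_blockF] at hk
    rw [if_pos hk, blockSize, hk, ← Real.rpow_natCast, ← Real.rpow_mul two_pos.le]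
    ring
  · intro k _ hk
    rw [mem_piFinset_blockF] at hk
    rw [if_neg hk, mul_zero]

/-- The embedding of `S^{s}_p W` into a weighted `ℓ_p` space of Fourier coefficients. -/
theorem coeff_le_sobolev {q C : ℝ} (hq1 : 1 < q) (hq2 : q ≤ 2)
    (hC : ∀ (J : Type) [Fintype J] (S : Finset ℤ) (c : ℤ → EuclideanSpace ℂ J),
      ∑ k ∈ S, ENNReal.ofReal ((1 + |(k:ℝ)|) ^ (q - 2)) * ‖c k‖ₑ ^ q
        ≤ ENNReal.ofReal C * ∫⁻ x, ‖vecTrig S c x‖ₑ ^ q ∂unitVol)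
    (d : ℕ) (s : ℝ) (f : (Fin d → ℝ) → ℂ) :
    ∑' k, (ENNReal.ofReal (blockSize k ^ (s - (2 / q - 1))) * ‖fCoeff d f k‖ₑ) ^ q
      ≤ ENNReal.ofReal C ^ d * ∫⁻ x in cube d, ((∑' j : Fin d → ℕ,
        (ENNReal.ofReal ((2:ℝ) ^ (((∑ i, j i : ℕ) : ℝ) * s)) *
          (‖blockProj d f j x‖₊ : ℝ≥0∞)) ^ (2:ℕ)) ^ ((1:ℝ)/2)) ^ q := by
  rw [ENNReal.tsum_eq_iSup_sum]
  refine iSup_le fun F => ?_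
  set n := F.sup fun k => Finset.univ.sup (blockIdx k) with hn
  have hFn : ∀ k ∈ F, ∀ i, blockIdx k i ≤ n := fun k hk i =>
    (Finset.le_sup (f := blockIdx k) (Finset.mem_univ i)).trans
      (Finset.le_sup (f := fun k => Finset.univ.sup (blockIdx k)) hk)
  set S := Finset.Ioo (-(2:ℤ) ^ n) (2 ^ n) with hS
  have hSn : ∀ k : Fin d → ℤ, k ∈ Fintype.piFinset (fun _ : Fin d => S) ↔ ∀ i, blockIdx k i ≤ n := by
    intro k
    rw [Fintype.mem_piFinset]
    refine forall_congr' fun i => ?_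
    rw [hS, Finset.mem_Ioo, ← abs_lt, Int.abs_eq_natAbs, blockIdx, Nat.size_le]
    exact_mod_cast Iff.rfl
  have hFS : F ⊆ Fintype.piFinset (fun _ : Fin d => S) := fun k hk => (hSn k).2 (hFn k hk)
  set JJ : Finset (Fin d → ℕ) := Fintype.piFinset fun _ => Finset.range (n + 1) with hJJ
  have hJn : ∀ j : Fin d → ℕ, j ∈ JJ ↔ ∀ i, j i ≤ n := by
    intro j; simp [hJJ, Fintype.mem_piFinset]
  set c : (Fin d → ℤ) → EuclideanSpace ℂ JJ := fun k => WithLp.toLp 2 fun j : JJ =>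
    if blockIdx k = j.1 then ((blockSize k ^ s : ℝ) : ℂ) * fCoeff d f k else 0 with hc
  have hmain := paley_multi hC JJ S d c
  refine (Finset.sum_le_sum_of_subset hFS).trans ?_
  refine (Finset.sum_le_sum fun k hk => ?_).trans (hmain.trans ?_)
  · have hk' : blockIdx k ∈ JJ := (hJn _).2 ((hSn k).1 hk)
    have h1 : ‖c k ⟨blockIdx k, hk'⟩‖ₑ ≤ ‖c k‖ₑ := by
      rw [← ofReal_norm, ← ofReal_norm]
      exact ENNReal.ofReal_le_ofReal (PiLp.norm_apply_le (c k) _)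
    have h2 : ‖c k ⟨blockIdx k, hk'⟩‖ₑ = ENNReal.ofReal (blockSize k ^ s) * ‖fCoeff d f k‖ₑ := by
      simp only [hc, if_true, enorm_mul]
      congr 1
      rw [← ofReal_norm, Complex.norm_real, Real.norm_of_nonneg
        (Real.rpow_nonneg (blockSize_pos k).le _)]
    have hN := blockSize_pos k
    calc (ENNReal.ofReal (blockSize k ^ (s - (2 / q - 1))) * ‖fCoeff d f k‖ₑ) ^ q
        = ENNReal.ofReal (blockSize k ^ (q - 2)) *
          (ENNReal.ofReal (blockSize k ^ s) * ‖fCoeff d f k‖ₑ) ^ q := by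
          rw [ENNReal.mul_rpow_of_nonneg _ _ (by linarith),
            ENNReal.mul_rpow_of_nonneg _ _ (by linarith), ← mul_assoc,
            ENNReal.ofReal_rpow_of_nonneg (by positivity) (by linarith),
            ENNReal.ofReal_rpow_of_nonneg (by positivity) (by linarith),
            ← ENNReal.ofReal_mul (by positivity), ← Real.rpow_mul hN.le, ← Real.rpow_mul hN.le,
            ← Real.rpow_add hN]
          congr 4
          field_simp
          ring
      _ ≤ ENNReal.ofReal (wt d k ^ (q - 2)) * ‖c k‖ₑ ^ q := by
          refine mul_le_mul' (ENNReal.ofReal_le_ofReal ?_) ?_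
          · exact Real.rpow_le_rpow_of_nonpos (wt_pos d k) (wt_le_blockSize k) (by linarith)
          · rw [← h2]
            exact ENNReal.rpow_le_rpow h1 (by linarith)
  · rw [← volume_restrict_cube]
    gcongr with x
    have hG : ‖vecTrigMulti d S c x‖ₑ = (‖vecTrigMulti d S c x‖ₑ ^ (2:ℕ)) ^ ((1:ℝ)/2) := by
      rw [← ENNReal.rpow_natCast, ← ENNReal.rpow_mul]; norm_num
    rw [hG, enorm_sq_eq_sum]
    gcongr
    refine le_trans (le_of_eq ?_) (ENNReal.sum_le_tsum JJ)
    rw [← Finset.sum_coe_sort JJ]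
    refine Finset.sum_congr rfl fun j _ => ?_
    have h3 : vecTrigMulti d S c x j = (((2:ℝ) ^ (((∑ i, j.1 i : ℕ) : ℝ) * s) : ℝ) : ℂ) *
        blockProj d f j.1 x := by
      unfold vecTrigMulti blockProj
      rw [← vecTrigMulti_block (n := n) (fCoeff d f) s x j.1 ((hJn _).1 j.2)]
      simp [hc, hS]
    rw [h3, enorm_mul, ← ofReal_norm, Complex.norm_real, Real.norm_of_nonneg (by positivity)]
    rfl

theorem coeff_le_L2 (d : ℕ) {f : (Fin d → ℝ) → ℂ} (hf : IntegrableOn f (cube d)) :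
    ∑' k, ‖fCoeff d f k‖ₑ ^ (2:ℝ) ≤ ∫⁻ x in cube d, ‖f x‖ₑ ^ (2:ℝ) := by
  by_cases hfin : ∫⁻ x in cube d, ‖f x‖ₑ ^ (2:ℝ) = ∞
  · rw [hfin]; exact le_top
  have hmem : MemLp f 2 (volume.restrict (cube d)) := by
    refine ⟨hf.aestronglyMeasurable, ?_⟩
    rw [eLpNorm_eq_lintegral_rpow_enorm_toReal (by simp) (by simp)]
    exact ENNReal.rpow_lt_top_of_nonneg (by simp) (by simpa using hfin)
  rw [ENNReal.tsum_eq_iSup_sum]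
  refine iSup_le fun F => ?_
  have := bessel_scalar (μ := volume.restrict (cube d)) (expk d)
    (fun k => (continuous_expk d k).aestronglyMeasurable) (fun k x => (norm_expk d k x).le)
    (fun k l => by
      simp_rw [conj_expk, mul_comm (expk d (-k) _), expk_mul_neg, integral_expk, sub_eq_zero]
      simp [eq_comm]) F hmem
  simp_rw [conj_expk, mul_comm (expk d _ _)] at this
  simpa [fCoeff] using this

theorem one_lt_toReal_le_two {p : ℝ≥0∞} (hp1 : 1 < p) (hp2 : p ≤ 2) :
    p ≠ ∞ ∧ 1 < p.toReal ∧ p.toReal ≤ 2 := by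
  have hptop : p ≠ ∞ := (hp2.trans_lt (by simp)).ne
  refine ⟨hptop, ?_, ?_⟩
  · rw [← ENNReal.toReal_one]
    exact (ENNReal.toReal_lt_toReal (by simp) hptop).2 hp1
  · rw [← ENNReal.toReal_ofNat 2]
    exact (ENNReal.toReal_le_toReal hptop (by simp)).2 hp2

theorem le_one_of_rpow_inv_le_one {q : ℝ} (hq : 0 < q) {I : ℝ≥0∞} (h : I ^ (1 / q) ≤ 1) :
    I ≤ 1 := by
  have := ENNReal.rpow_le_rpow h hq.le
  rwa [← ENNReal.rpow_mul, one_div, inv_mul_cancel₀ hq.ne', ENNReal.rpow_one,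
    ENNReal.one_rpow] at this

/-- The unit ball of `S^r_p W` embeds into a weighted `ℓ_p` space of Fourier coefficients. -/
theorem exists_coeff_bound (d : ℕ) {p : ℝ≥0∞} (hp1 : 1 < p) (hp2 : p ≤ 2) :
    ∃ C : ℝ, 0 < C ∧ ∀ r : ℝ, 2 / p.toReal - 1 ≤ r → ∀ f ∈ unitBall d (sobolevNorm d r p),
      ∑' k, (ENNReal.ofReal (blockSize k ^ (r - (2 / p.toReal - 1))) * ‖fCoeff d f k‖ₑ) ^ p.toReal
        ≤ ENNReal.ofReal C := by
  obtain ⟨hptop, hq1, hq2⟩ := one_lt_toReal_le_two hp1 hp2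
  obtain ⟨C, hC0, hC⟩ := paley_one hq1 hq2
  refine ⟨max (C ^ d) 1, by positivity, fun r hr f hf => ?_⟩
  obtain ⟨hint, hnorm⟩ := hf
  by_cases h0 : r = 0
  · subst h0
    have hq : p.toReal = 2 := by
      refine le_antisymm hq2 ?_
      rw [sub_nonpos, div_le_one (by linarith)] at hr
      exact hr
    have hp : p = 2 := by
      rw [← ENNReal.toReal_eq_toReal_iff' hptop (by simp), hq]; simp
    have hnorm' : (∫⁻ x in cube d, ‖f x‖ₑ ^ (2:ℝ)) ^ (1 / (2:ℝ)) ≤ 1 := by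
      rw [sobolevNorm, if_pos rfl, LqNorm, eLpNorm_eq_lintegral_rpow_enorm_toReal
        (by rw [hp]; simp) hptop, hq] at hnorm
      exact hnorm
    have h2 := (coeff_le_L2 d hint).trans (le_one_of_rpow_inv_le_one two_pos hnorm')
    rw [hq]
    simp only [div_self (two_ne_zero' ℝ), sub_self, Real.rpow_zero, ENNReal.ofReal_one, one_mul]
    exact h2.trans (by rw [← ENNReal.ofReal_one]; exact ENNReal.ofReal_le_ofReal (le_max_right _ _))
  · rw [sobolevNorm, if_neg h0] at hnorm
    have h1 := le_one_of_rpow_inv_le_one (by linarith) hnorm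
    refine (coeff_le_sobolev hq1 hq2 hC d r f).trans ?_
    refine (mul_le_mul' le_rfl h1).trans ?_
    rw [mul_one, ← ENNReal.ofReal_pow hC0.le]
    exact ENNReal.ofReal_le_ofReal (le_max_left _ _)

/-- Stechkin-type estimate: the terms of an `ℓ_q` family remaining after removing its large
terms. -/
theorem exists_greedy {ι : Type*} (u : ι → ℝ≥0∞) {q v : ℝ} (hq : 0 < q) (hv : 0 < v)
    (hu : ∑' k, u k ^ q ≤ ENNReal.ofReal v) {m : ℕ} (hm : 1 ≤ m) :
    ∃ Λ : Finset ι, Λ.card ≤ m ∧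
      (∀ k ∉ Λ, u k ≤ ENNReal.ofReal (v ^ (1 / q) * (m : ℝ) ^ (-(1 / q)))) ∧
      ∀ η : ℝ, q ≤ η → ∀ w : ι → ℝ≥0∞, (∀ k ∈ Λ, w k = 0) → (∀ k ∉ Λ, w k = u k) →
        (∑' k, w k ^ η) ^ (1 / η) ≤ ENNReal.ofReal (v ^ (1 / q) * (m : ℝ) ^ (-(1 / q - 1 / η))) := by
  classical
  have hm0 : (0:ℝ) < m := by exact_mod_cast hm
  have hε : 0 < v / m := by positivity
  have hεne : ENNReal.ofReal (v / m) ≠ 0 := by simpa using hε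
  obtain ⟨hfin, hcard⟩ := ENNReal.finset_card_const_le_le_of_tsum_le
    (a := fun k => u k ^ q) (ENNReal.ofReal_ne_top (r := v)) hu hεne
  have hsmall : ∀ k ∉ hfin.toFinset, u k ^ q ≤ ENNReal.ofReal (v / m) := by
    intro k hk
    rw [Set.Finite.mem_toFinset, Set.mem_ofPred_eq, not_le] at hk
    exact hk.le
  have hsmall' : ∀ k ∉ hfin.toFinset, u k ≤ ENNReal.ofReal (v / m) ^ (1 / q) := by
    intro k hk
    rw [one_div, ENNReal.le_rpow_inv_iff hq]
    exact hsmall k hk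
  refine ⟨hfin.toFinset, ?_, ?_, ?_⟩
  · rw [← ENNReal.ofReal_div_of_pos hε, div_div_cancel₀ hv.ne', ENNReal.ofReal_natCast] at hcard
    exact_mod_cast hcard
  · intro k hk
    refine (hsmall' k hk).trans_eq ?_
    rw [ENNReal.ofReal_rpow_of_pos hε, Real.div_rpow hv.le hm0.le, Real.rpow_neg hm0.le,
      div_eq_mul_inv]
  · intro η hη w hw0 hw1
    have hη0 : 0 < η := hq.trans_le hη
    have hbd : ∑' k, w k ^ η ≤ ENNReal.ofReal ((v / m) ^ (η / q - 1)) * ENNReal.ofReal v := by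
      refine le_trans ?_ (mul_le_mul' le_rfl hu)
      rw [← ENNReal.tsum_mul_left]
      refine ENNReal.tsum_le_tsum fun k => ?_
      by_cases hk : k ∈ hfin.toFinset
      · rw [hw0 k hk, ENNReal.zero_rpow_of_pos hη0]
        exact zero_le
      · rw [hw1 k hk]
        calc u k ^ η = u k ^ (η - q) * u k ^ q := by
              rw [← ENNReal.rpow_add_of_nonneg _ _ (by linarith) hq.le, sub_add_cancel]
          _ ≤ _ := by
              refine mul_le_mul' ?_ le_rfl
              refine (ENNReal.rpow_le_rpow (hsmall' k hk) (by linarith)).trans_eq ?_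
              rw [ENNReal.ofReal_rpow_of_pos hε, ENNReal.ofReal_rpow_of_pos (by positivity),
                ← Real.rpow_mul hε.le]
              congr 2
              field_simp
    refine (ENNReal.rpow_le_rpow hbd (by positivity)).trans_eq ?_
    rw [← ENNReal.ofReal_mul (by positivity), ENNReal.ofReal_rpow_of_pos (by positivity)]
    congr 1
    rw [Real.mul_rpow (by positivity) hv.le, ← Real.rpow_mul hε.le, Real.div_rpow hv.le hm0.le,
      div_mul_eq_mul_div, ← Real.rpow_add hv, Real.rpow_neg hm0.le, div_eq_mul_inv]
    have e1 : (η / q - 1) * (1 / η) = 1 / q - 1 / η := by field_simp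
    rw [e1]
    congr 2
    ring

theorem sigmaF_le {d : ℕ} {f : (Fin d → ℝ) → ℂ} (hf : IntegrableOn f (cube d)) {p η : ℝ≥0∞}
    (hp : p ≠ ∞) (hp0 : 0 < p.toReal) (hη : p ≤ η) {v : ℝ} (hv : 0 < v)
    (Λ₁ : Finset (Fin d → ℤ))
    (hsum : ∑' k, (if k ∈ Λ₁ then 0 else ‖fCoeff d f k‖ₑ) ^ p.toReal ≤ ENNReal.ofReal v)
    {m₁ m : ℕ} (hm₁ : 1 ≤ m₁) (hm : Λ₁.card + m₁ ≤ m) :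
    sigmaF d m (wienerNorm d 0 η) f ≤
      ENNReal.ofReal (v ^ (1 / p.toReal) * (m₁ : ℝ) ^ (-(1 / p.toReal - 1 / η.toReal))) := by
  classical
  obtain ⟨Λ₂, hcard, hsup, hfin⟩ := exists_greedy _ hp0 hv hsum hm₁
  set Λ := Λ₁ ∪ Λ₂ with hΛ
  have hmem : (fun x => ∑ k ∈ Λ, fCoeff d f k * expk d k x) ∈ trigPoly d m :=
    ⟨Λ, fCoeff d f, (Finset.card_union_le _ _).trans (by omega), rfl⟩
  refine (iInf₂_le _ hmem).trans ?_
  have hcoef : ∀ k, fCoeff d (f - fun x => ∑ k ∈ Λ, fCoeff d f k * expk d k x) k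
      = if k ∈ Λ then 0 else fCoeff d f k := by
    intro k
    rw [fCoeff_sub d hf (integrable_trig d _ _), fCoeff_trig]
    split_ifs <;> simp
  have hnn : ∀ z : ℂ, (‖z‖₊ : ℝ≥0∞) = ‖z‖ₑ := fun z => rfl
  unfold wienerNorm
  simp only [hcoef, Real.rpow_zero, ENNReal.ofReal_one, one_mul, hnn]
  split_ifs with htop
  · subst htop
    refine iSup_le fun k => ?_
    simp only [ENNReal.toReal_top]
    by_cases hk : k ∈ Λ
    · simp [hk]
    · rw [if_neg hk]
      rw [hΛ, Finset.mem_union, not_or] at hk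
      simpa [hk.1] using hsup k hk.2
  · refine hfin η.toReal ((ENNReal.toReal_le_toReal hp htop).2 hη) _ ?_ ?_
    · intro k hk
      simp [hΛ, hk]
    · intro k hk
      by_cases hk1 : k ∈ Λ₁ <;> simp [hΛ, hk, hk1]

/-- The hyperbolic cross of frequencies in dyadic blocks `I_j` with `‖j‖₁ ≤ n`. -/
def hypCross (d n : ℕ) : Finset (Fin d → ℤ) :=
  ((Fintype.piFinset fun _ : Fin d => Finset.range (n + 1)).filter fun j => ∑ i, j i ≤ n).biUnion
    fun j => Fintype.piFinset fun i => blockF (j i)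

theorem mem_hypCross {d n : ℕ} {k : Fin d → ℤ} : k ∈ hypCross d n ↔ ∑ i, blockIdx k i ≤ n := by
  unfold hypCross
  simp_rw [Finset.mem_biUnion, mem_piFinset_blockF, Finset.mem_filter, Fintype.mem_piFinset,
    Finset.mem_range, Nat.lt_succ_iff]
  constructor
  · rintro ⟨j, ⟨-, h⟩, rfl⟩; exact h
  · intro h
    exact ⟨_, ⟨fun i => (Finset.single_le_sum (fun _ _ => Nat.zero_le _)
      (Finset.mem_univ i)).trans h, h⟩, rfl⟩

theorem card_blockF_le (n : ℕ) : (blockF n).card ≤ 2 ^ n := by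
  rcases Nat.eq_zero_or_pos n with rfl | hn
  · have : blockF 0 ⊆ {0} := by
      intro k hk
      rw [mem_blockF, Nat.size_eq_zero, Int.natAbs_eq_zero] at hk
      simp [hk]
    simpa using Finset.card_le_card this
  · obtain ⟨m, rfl⟩ := Nat.exists_eq_succ_of_ne_zero hn.ne'
    have : blockF (m + 1) ⊆ Finset.Ioc (-(2 : ℤ) ^ (m + 1)) (-2 ^ m) ∪
        Finset.Ico ((2 : ℤ) ^ m) (2 ^ (m + 1)) := by
      intro k hk
      simp only [blockF, Finset.mem_filter, Nat.add_sub_cancel] at hk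
      obtain ⟨-, ⟨h, -⟩ | ⟨-, h1, h2⟩⟩ := hk
      · omega
      · rw [Finset.mem_union, Finset.mem_Ioc, Finset.mem_Ico]
        rw [abs_lt] at h2
        rcases le_abs.1 h1 with h | h
        · exact Or.inr ⟨h, h2.2⟩
        · exact Or.inl ⟨h2.1, by linarith⟩
    refine (Finset.card_le_card this).trans ((Finset.card_union_le _ _).trans ?_)
    rw [Int.card_Ioc, Int.card_Ico]
    have : (2 : ℤ) ^ (m + 1) = 2 ^ m + 2 ^ m := by ring
    have h3 : (-(2:ℤ) ^ m - -2 ^ (m + 1)) = ((2 ^ m : ℕ) : ℤ) := by push_cast; linarith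
    have h4 : ((2:ℤ) ^ (m + 1) - 2 ^ m) = ((2 ^ m : ℕ) : ℤ) := by push_cast; linarith
    rw [h3, h4, Int.toNat_natCast, pow_succ]
    omega

theorem card_hypCross_le (e n : ℕ) : (hypCross (e + 1) n).card ≤ (n + 1) ^ e * 2 ^ (n + 1) := by
  unfold hypCross
  refine Finset.card_biUnion_le.trans ?_
  calc ∑ j ∈ (Fintype.piFinset fun _ : Fin (e + 1) => Finset.range (n + 1)).filter
          (fun j => ∑ i, j i ≤ n), (Fintype.piFinset fun i => blockF (j i)).card
      ≤ ∑ j ∈ (Fintype.piFinset fun _ : Fin (e + 1) => Finset.range (n + 1)).filter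
          (fun j => ∑ i, j i ≤ n), 2 ^ ∑ i, j i := by
        refine Finset.sum_le_sum fun j _ => ?_
        rw [Fintype.card_piFinset, ← Finset.prod_pow_eq_pow_sum]
        exact Finset.prod_le_prod' fun i _ => card_blockF_le _
    _ = ∑ N ∈ Finset.range (n + 1),
          ∑ j ∈ ((Fintype.piFinset fun _ : Fin (e + 1) => Finset.range (n + 1)).filter
          (fun j => ∑ i, j i ≤ n)).filter (fun j => ∑ i, j i = N), 2 ^ ∑ i, j i := by
        rw [Finset.sum_fiberwise_of_maps_to]
        intro j hj
        rw [Finset.mem_filter] at hj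
        exact Finset.mem_range.2 (Nat.lt_succ_of_le hj.2)
    _ ≤ ∑ N ∈ Finset.range (n + 1), (n + 1) ^ e * 2 ^ N := by
        refine Finset.sum_le_sum fun N _ => ?_
        rw [Finset.sum_congr rfl (g := fun _ => 2 ^ N)
          (fun j hj => by rw [(Finset.mem_filter.1 hj).2]), Finset.sum_const, smul_eq_mul]
        refine Nat.mul_le_mul_right _ ?_
        have : (Fintype.piFinset fun _ : Fin e => Finset.range (n + 1)).card = (n + 1) ^ e := by
          simp [Fintype.card_piFinset]
        rw [← this]
        refine Finset.card_le_card_of_injOn Fin.tail ?_ ?_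
        · intro j hj
          simp only [Finset.coe_filter, Finset.mem_filter, Fintype.mem_piFinset,
            Set.mem_ofPred_eq] at hj
          simp only [Finset.mem_coe, Fintype.mem_piFinset]
          exact fun i => hj.1.1 i.succ
        · intro j hj j' hj' h
          simp only [Finset.coe_filter, Finset.mem_filter, Set.mem_ofPred_eq] at hj hj'
          have h1 : ∀ i : Fin e, j i.succ = j' i.succ := fun i => congrFun h i
          have h2 := hj.2.trans hj'.2.symm
          rw [Fin.sum_univ_succ, Fin.sum_univ_succ, Finset.sum_congr rfl fun i _ => h1 i] at h2
          funext i
          refine Fin.cases (by omega) h1 i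
    _ ≤ (n + 1) ^ e * 2 ^ (n + 1) := by
        rw [← Finset.mul_sum]
        refine Nat.mul_le_mul_left _ ?_
        exact (Nat.geomSum_lt le_rfl fun N hN => Finset.mem_range.1 hN).le

theorem one_div_toReal_sub_nonneg {p η : ℝ≥0∞} (hp : p ≠ ∞) (hp0 : 0 < p.toReal) (hη : p ≤ η) :
    0 ≤ 1 / p.toReal - 1 / η.toReal := by
  by_cases h : η = ∞
  · subst h; simp
  · rw [sub_nonneg]
    exact one_div_le_one_div_of_le hp0 ((ENNReal.toReal_le_toReal hp h).2 hη)

theorem sigmaClass_le_critical (d : ℕ) {p η : ℝ≥0∞} (hp1 : 1 < p) (hp2 : p ≤ 2) (hη : p ≤ η) :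
    ∃ C : ℝ, 0 < C ∧ ∀ m : ℕ, 1 ≤ m →
      sigmaClass d m (sobolevNorm d (2 / p.toReal - 1) p) (wienerNorm d 0 η) ≤
        ENNReal.ofReal (C * (m : ℝ) ^ (-(1 / p.toReal - 1 / η.toReal))) := by
  obtain ⟨hptop, hq1, -⟩ := one_lt_toReal_le_two hp1 hp2
  obtain ⟨C, hC0, hC⟩ := exists_coeff_bound d hp1 hp2
  refine ⟨C ^ (1 / p.toReal), by positivity, fun m hm => iSup₂_le fun f hf => ?_⟩
  refine sigmaF_le hf.1 hptop (by linarith) hη hC0 ∅ ?_ hm (by simp)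
  simpa using hC _ le_rfl f hf

theorem rpow_neg_le_of_le_mul {x y c a : ℝ} (hx : 0 < x) (hc : 0 < c) (ha : 0 ≤ a)
    (h : x ≤ c * y) : y ^ (-a) ≤ c ^ a * x ^ (-a) := by
  have h1 : x / c ≤ y := by rwa [div_le_iff₀' hc]
  refine (Real.rpow_le_rpow_of_nonpos (by positivity) h1 (by linarith)).trans_eq ?_
  rw [Real.div_rpow hx.le hc.le, Real.rpow_neg hc.le, div_inv_eq_mul, mul_comm]

theorem one_le_logStar (m : ℕ) : 1 ≤ logStar m := le_max_right _ _

theorem eventually_logStar_pow_le (e : ℕ) : ∃ m₀ : ℕ, 2 ≤ m₀ ∧ ∀ m : ℕ, m₀ ≤ m →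
    8 * logStar m ^ e ≤ m ∧ logStar m = Real.logb 2 m := by
  have h1 := (isLittleO_pow_log_id_atTop (n := e)).bound
    (c := Real.log 2 ^ e / 8) (by have := Real.log_pos one_lt_two; positivity)
  have h2 := tendsto_natCast_atTop_atTop (R := ℝ) |>.eventually h1
  obtain ⟨m₁, hm₁⟩ := Filter.eventually_atTop.1 h2
  refine ⟨max m₁ 2, le_max_right _ _, fun m hm => ?_⟩
  have hm2 : 2 ≤ m := (le_max_right _ _).trans hm
  have hlog2 := Real.log_pos one_lt_two
  have hlogm : Real.log 2 ≤ Real.log m := Real.log_le_log two_pos (by exact_mod_cast hm2)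
  have hL : logStar m = Real.logb 2 m := by
    refine max_eq_left ?_
    rw [Real.logb, le_div_iff₀ hlog2, one_mul]
    exact hlogm
  refine ⟨?_, hL⟩
  have h3 := hm₁ m ((le_max_left _ _).trans hm)
  rw [Real.norm_of_nonneg (pow_nonneg (hlog2.le.trans hlogm) _), id, Real.norm_of_nonneg
    (by positivity)] at h3
  rw [hL, Real.logb, div_pow]
  have := pow_pos hlog2 e
  rw [mul_div_assoc', div_le_iff₀ this]
  linarith

theorem sigmaClass_le (e : ℕ) {p η : ℝ≥0∞} (hp1 : 1 < p) (hp2 : p ≤ 2) (hη : p ≤ η) {r : ℝ}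
    (hr : 2 / p.toReal - 1 < r) :
    ∃ C : ℝ, 0 < C ∧ ∃ m₀ : ℕ, ∀ m : ℕ, m₀ ≤ m →
      sigmaClass (e + 1) m (sobolevNorm (e + 1) r p) (wienerNorm (e + 1) 0 η) ≤
        ENNReal.ofReal (C * ((m : ℝ) ^ (-(r + 1 - 1 / p.toReal - 1 / η.toReal)) *
          logStar m ^ ((e : ℝ) * (r + 1 - 2 / p.toReal)))) := by
  obtain ⟨hptop, hq1, -⟩ := one_lt_toReal_le_two hp1 hp2
  obtain ⟨C, hC0, hC⟩ := exists_coeff_bound (e + 1) hp1 hp2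
  have hβ := one_div_toReal_sub_nonneg hptop (by linarith) hη
  set q := p.toReal with hq
  set β := 1 / q - 1 / η.toReal with hβdef
  set δ := r - (2 / q - 1) with hδdef
  have hq0 : 0 < q := by linarith
  have hδ : 0 < δ := by rw [hδdef]; linarith
  obtain ⟨m₀, hm₀, hlog⟩ := eventually_logStar_pow_le e
  refine ⟨C ^ (1 / q) * 8 ^ δ * 4 ^ β, by positivity, m₀, fun m hm => iSup₂_le fun f hf => ?_⟩
  obtain ⟨hL8, hL⟩ := hlog m hm
  set L := logStar m with hLdef
  have hL1 : 1 ≤ L := one_le_logStar m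
  have hLe : 0 < L ^ e := by positivity
  have hm2 : 2 ≤ m := hm₀.trans hm
  have hm0 : (0:ℝ) < m := by exact_mod_cast (by omega : 0 < m)
  set x : ℝ := m / (8 * L ^ e) with hx
  have hx1 : 1 ≤ x := by rwa [hx, one_le_div (by positivity)]
  have hx0 : 0 < x := by linarith
  obtain ⟨n, hn1, hn2⟩ := exists_nat_pow_near hx1 one_lt_two
  have hxm : 8 * L ^ e * x = m := by rw [hx]; field_simp
  have hnL : (n + 1 : ℝ) ≤ L := by
    rw [hL, Real.le_logb_iff_rpow_le one_lt_two hm0]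
    have : (2:ℝ) ^ ((n : ℝ) + 1) = 2 ^ n * 2 := by
      rw [Real.rpow_add two_pos, Real.rpow_natCast, Real.rpow_one]
    rw [this]
    have : 1 ≤ L ^ e := one_le_pow₀ hL1
    nlinarith
  have hcard : (((hypCross (e + 1) n).card : ℕ) : ℝ) ≤ m / 4 := by
    have h1 : (((hypCross (e + 1) n).card : ℕ) : ℝ) ≤ ((n : ℝ) + 1) ^ e * 2 ^ (n + 1) := by
      exact_mod_cast card_hypCross_le e n
    refine h1.trans ?_
    have h2 : ((n : ℝ) + 1) ^ e ≤ L ^ e := pow_le_pow_left₀ (by positivity) hnL e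
    calc ((n : ℝ) + 1) ^ e * 2 ^ (n + 1) ≤ L ^ e * (2 * x) := by
          rw [pow_succ, mul_comm ((2:ℝ) ^ n)]; gcongr
      _ = m / 4 := by rw [← hxm]; ring
  have hcard' : 4 * (hypCross (e + 1) n).card ≤ m := by
    have : 4 * (((hypCross (e + 1) n).card : ℕ) : ℝ) ≤ m := by linarith
    exact_mod_cast this
  have hsum : ∑' k, (if k ∈ hypCross (e + 1) n then 0 else ‖fCoeff (e + 1) f k‖ₑ) ^ q
      ≤ ENNReal.ofReal (C * x ^ (-(δ * q))) := by
    rw [mul_comm, ENNReal.ofReal_mul (by positivity)]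
    refine le_trans ?_ (mul_le_mul' le_rfl (hC r hr.le f hf))
    rw [← ENNReal.tsum_mul_left]
    refine ENNReal.tsum_le_tsum fun k => ?_
    split_ifs with hk
    · rw [ENNReal.zero_rpow_of_pos hq0]; exact zero_le
    · rw [mem_hypCross, not_le] at hk
      rw [ENNReal.mul_rpow_of_nonneg _ _ hq0.le, ← mul_assoc]
      refine le_mul_of_one_le_left zero_le ?_
      have hN := blockSize_pos k
      rw [ENNReal.ofReal_rpow_of_pos (by positivity), ← ENNReal.ofReal_mul (by positivity),
        ENNReal.one_le_ofReal, ← Real.rpow_mul hN.le, Real.rpow_neg hx0.le,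
        ← div_eq_inv_mul, one_le_div (by positivity)]
      refine Real.rpow_le_rpow hx0.le ?_ (by positivity)
      exact hn2.le.trans (pow_le_pow_right₀ one_le_two hk)
  refine (sigmaF_le (v := C * x ^ (-(δ * q))) (m₁ := m / 2) (m := m) hf.1 hptop hq0 hη
    (by positivity) _ hsum (by omega) (by omega)).trans (ENNReal.ofReal_le_ofReal ?_)
  have e1 : (C * x ^ (-(δ * q))) ^ (1 / q) = C ^ (1 / q) * x ^ (-δ) := by
    rw [Real.mul_rpow hC0.le (by positivity), ← Real.rpow_mul hx0.le]
    congr 2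
    field_simp
  have e2 : x ^ (-δ) = 8 ^ δ * (m : ℝ) ^ (-δ) * L ^ ((e : ℝ) * δ) := by
    rw [hx, Real.div_rpow hm0.le (by positivity), Real.mul_rpow (by norm_num) hLe.le,
      Real.rpow_neg (by norm_num : (0:ℝ) ≤ 8), Real.rpow_neg hLe.le, Real.rpow_mul (by positivity),
      Real.rpow_natCast, div_eq_mul_inv, mul_inv, inv_inv, inv_inv]
    ring
  have e3 : ((m / 2 : ℕ) : ℝ) ^ (-β) ≤ 4 ^ β * (m : ℝ) ^ (-β) := by
    refine rpow_neg_le_of_le_mul hm0 (by norm_num) hβ ?_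
    exact_mod_cast (by omega : m ≤ 4 * (m / 2))
  have e4 : (m : ℝ) ^ (-(r + 1 - 1 / q - 1 / η.toReal)) = (m : ℝ) ^ (-δ) * (m : ℝ) ^ (-β) := by
    rw [← Real.rpow_add hm0]
    congr 1
    rw [hδdef, hβdef]; ring
  have e5 : r + 1 - 2 / q = δ := by rw [hδdef]; ring
  rw [e1, e2, e4, e5]
  calc _ ≤ C ^ (1 / q) * (8 ^ δ * (m : ℝ) ^ (-δ) * L ^ ((e : ℝ) * δ)) *
        (4 ^ β * (m : ℝ) ^ (-β)) := by gcongr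
    _ = _ := by ring

/-- Coefficients of a modulated Fejér kernel with frequencies in the dyadic block `I_j`. -/
def fejerCoeff (j : ℕ) (k : ℤ) : ℝ :=
  (((Finset.range (2 ^ (j - 2)) ×ˢ Finset.range (2 ^ (j - 2))).filter fun l =>
    (2:ℤ) ^ (j - 1) + ((l.1 : ℤ) + l.2) = k).card : ℝ) / 2 ^ (j - 2)

/-- A modulated Fejér kernel with frequencies in the dyadic block `I_j`. -/
def fejer (j : ℕ) (x : ℝ) : ℂ := ∑ k ∈ blockF j, (fejerCoeff j k : ℂ) * char1 k x

theorem fejerCoeff_nonneg (j : ℕ) (k : ℤ) : 0 ≤ fejerCoeff j k := by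
  unfold fejerCoeff; positivity

theorem mem_blockF_fejer {i : ℕ} {t : ℕ} (ht : t < 2 ^ (i + 2)) :
    (2:ℤ) ^ (i + 2) + t ∈ blockF (i + 3) := by
  have h : (2:ℤ) ^ (i + 2) + t = ((2 ^ (i + 2) + t : ℕ) : ℤ) := by push_cast; rfl
  rw [mem_blockF, h, Int.natAbs_natCast]
  refine le_antisymm (Nat.size_le.2 ?_) (Nat.lt_size.2 (by omega))
  rw [pow_succ 2 (i + 2)]; omega

theorem fejer_eq (i : ℕ) (x : ℝ) : fejer (i + 3) x =
    char1 (2 ^ (i + 2)) x * (∑ l ∈ Finset.range (2 ^ (i + 1)), char1 l x) ^ 2 / 2 ^ (i + 1) := by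
  set N := 2 ^ (i + 1) with hN
  have hexp : (i + 3 - 2 = i + 1) ∧ (i + 3 - 1 = i + 2) := by omega
  unfold fejer fejerCoeff
  rw [hexp.1, hexp.2]
  have h1 : ∀ k : ℤ, ((((((Finset.range N ×ˢ Finset.range N).filter fun l =>
      (2:ℤ) ^ (i + 2) + ((l.1 : ℤ) + l.2) = k).card : ℝ) / 2 ^ (i + 1) : ℝ)) : ℂ) * char1 k x
      = (∑ l ∈ (Finset.range N ×ˢ Finset.range N).filter fun l =>
      (2:ℤ) ^ (i + 2) + ((l.1 : ℤ) + l.2) = k, char1 ((2:ℤ) ^ (i + 2) + ((l.1 : ℤ) + l.2)) x)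
        / 2 ^ (i + 1) := by
    intro k
    rw [Finset.sum_congr rfl (g := fun _ => char1 k x)
      (fun l hl => by rw [(Finset.mem_filter.1 hl).2]), Finset.sum_const, nsmul_eq_mul]
    push_cast
    ring
  rw [Finset.sum_congr rfl fun k _ => h1 k, ← Finset.sum_div]
  congr 1
  rw [Finset.sum_fiberwise_of_maps_to, Finset.sum_product, sq, Finset.sum_mul_sum, Finset.mul_sum]
  · refine Finset.sum_congr rfl fun l _ => ?_
    rw [Finset.mul_sum]
    refine Finset.sum_congr rfl fun l' _ => ?_
    rw [char1_add, char1_add]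
  · intro l hl
    rw [Finset.mem_product, Finset.mem_range, Finset.mem_range] at hl
    have := mem_blockF_fejer (i := i) (t := l.1 + l.2) (by rw [pow_succ 2 (i + 1)]; omega)
    push_cast at this
    exact this

theorem lintegral_sum_char1 (N : ℕ) :
    ∫⁻ x, ‖∑ l ∈ Finset.range N, char1 l x‖ₑ ^ 2 ∂unitVol = N := by
  have hcont : Continuous fun x => ∑ l ∈ Finset.range N, char1 l x :=
    continuous_finsetSum _ fun l _ => continuous_char1 l
  have hint : ∀ k l : ℕ, Integrable (fun x => (starRingEnd ℂ) (char1 k x) * char1 l x)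
      unitVol := by
    intro k l
    simp_rw [conj_char1, ← char1_add]
    exact Integrable.of_bound (continuous_char1 _).aestronglyMeasurable 1
      (Filter.Eventually.of_forall fun x => (norm_char1 _ x).le)
  have h1 : ∫ x, ((‖∑ l ∈ Finset.range N, char1 l x‖ ^ 2 : ℝ) : ℂ) ∂unitVol = N := by
    have : ∀ x, ((‖∑ l ∈ Finset.range N, char1 l x‖ ^ 2 : ℝ) : ℂ)
        = ∑ k ∈ Finset.range N, ∑ l ∈ Finset.range N,
          (starRingEnd ℂ) (char1 k x) * char1 l x := by
      intro x
      rw [← Finset.sum_mul_sum, ← map_sum, Complex.conj_mul']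
      push_cast; rfl
    simp_rw [this]
    rw [integral_finsetSum _ fun k _ => integrable_finsetSum _ fun l _ => hint k l]
    simp_rw [integral_finsetSum _ fun l _ => hint _ l, char1_orthonormal]
    have hN : ∀ k ∈ Finset.range N,
        (∑ l ∈ Finset.range N, if (k : ℤ) = (l : ℤ) then (1:ℂ) else 0) = 1 := by
      intro k hk
      simp_rw [Nat.cast_inj, Finset.sum_ite_eq, if_pos hk]
    rw [Finset.sum_congr rfl hN]
    simp
  rw [integral_complex_ofReal] at h1
  have h2 : ∫ x, ‖∑ l ∈ Finset.range N, char1 l x‖ ^ 2 ∂unitVol = N := by exact_mod_cast h1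
  have h3 : Integrable (fun x => ‖∑ l ∈ Finset.range N, char1 l x‖ ^ 2) unitVol := by
    refine Integrable.of_bound (C := (N : ℝ) ^ 2) (hcont.norm.pow 2).aestronglyMeasurable (Filter.Eventually.of_forall
      fun x => ?_)
    rw [Real.norm_of_nonneg (by positivity)]
    gcongr
    refine (norm_sum_le _ _).trans ?_
    simp [norm_char1]
  rw [← ENNReal.ofReal_natCast, ← h2, ofReal_integral_eq_lintegral_ofReal h3
    (Filter.Eventually.of_forall fun x => by positivity)]
  simp_rw [ENNReal.ofReal_pow (norm_nonneg _), ofReal_norm]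

theorem continuous_fejer (j : ℕ) : Continuous (fejer j) :=
  continuous_finsetSum _ fun k _ => continuous_const.mul (continuous_char1 k)

theorem lintegral_fejer_le {j : ℕ} (hj : 3 ≤ j) {p : ℝ} (hp : 1 ≤ p) :
    ∫⁻ x, ‖fejer j x‖ₑ ^ p ∂unitVol ≤ ENNReal.ofReal ((2:ℝ) ^ ((j : ℝ) * (p - 1))) := by
  obtain ⟨i, rfl⟩ := Nat.exists_eq_add_of_le' hj
  set N := 2 ^ (i + 1) with hN
  have hN0 : (0:ℝ) < N := by rw [hN]; positivity
  have hn : ∀ x, ‖fejer (i + 3) x‖ = ‖∑ l ∈ Finset.range N, char1 l x‖ ^ 2 / N := by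
    intro x
    rw [fejer_eq, norm_div, norm_mul, norm_char1, one_mul, norm_pow]
    simp [hN]
  have hle : ∀ x, ‖fejer (i + 3) x‖ ≤ N := by
    intro x
    rw [hn, div_le_iff₀ hN0, ← sq]
    gcongr
    refine (norm_sum_le _ _).trans ?_
    simp [norm_char1]
  have hpt : ∀ x, ‖fejer (i + 3) x‖ₑ ^ p ≤ ENNReal.ofReal ((N : ℝ) ^ (p - 1) / N) *
      ‖∑ l ∈ Finset.range N, char1 l x‖ₑ ^ 2 := by
    intro x
    rw [← ofReal_norm, ← ofReal_norm, ← ENNReal.ofReal_pow (norm_nonneg _),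
      ← ENNReal.ofReal_mul (by positivity), ENNReal.ofReal_rpow_of_nonneg (norm_nonneg _)
      (by linarith)]
    refine ENNReal.ofReal_le_ofReal ?_
    rw [div_mul_eq_mul_div, mul_div_assoc, ← hn]
    calc ‖fejer (i + 3) x‖ ^ p = ‖fejer (i + 3) x‖ ^ ((p - 1) + 1) := by rw [sub_add_cancel]
      _ = ‖fejer (i + 3) x‖ ^ (p - 1) * ‖fejer (i + 3) x‖ := by
          rw [Real.rpow_add_of_nonneg (norm_nonneg _) (by linarith) zero_le_one, Real.rpow_one]
      _ ≤ _ := by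
          gcongr
          exact hle x
  refine (lintegral_mono hpt).trans ?_
  rw [lintegral_const_mul' _ _ ENNReal.ofReal_ne_top, lintegral_sum_char1,
    ← ENNReal.ofReal_natCast, ← ENNReal.ofReal_mul (by positivity), div_mul_cancel₀ _ hN0.ne']
  refine ENNReal.ofReal_le_ofReal ?_
  rw [Real.rpow_mul two_pos.le, Real.rpow_natCast]
  refine Real.rpow_le_rpow hN0.le ?_ (by linarith)
  rw [hN]; push_cast
  exact pow_le_pow_right₀ one_le_two (by omega)

/-- Frequencies in `I_j` at which the modulated Fejér kernel has a large coefficient. -/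
def fejerPeak (j : ℕ) : Finset ℤ :=
  (Finset.Ico (2 ^ (j - 3)) (2 ^ (j - 2))).image fun t : ℕ => (2:ℤ) ^ (j - 1) + t

theorem fejerPeak_subset {j : ℕ} (hj : 3 ≤ j) : fejerPeak j ⊆ blockF j := by
  obtain ⟨i, rfl⟩ := Nat.exists_eq_add_of_le' hj
  intro k hk
  obtain ⟨t, ht, rfl⟩ := Finset.mem_image.1 hk
  rw [Finset.mem_Ico] at ht
  refine mem_blockF_fejer (ht.2.trans_le ?_)
  exact Nat.pow_le_pow_right (by norm_num) (by omega)

theorem card_fejerPeak {j : ℕ} (hj : 3 ≤ j) : 8 * (fejerPeak j).card = 2 ^ j := by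
  obtain ⟨i, rfl⟩ := Nat.exists_eq_add_of_le' hj
  rw [fejerPeak, Finset.card_image_of_injective _ fun a b h => by simpa using h, Nat.card_Ico]
  have h1 : i + 3 - 3 = i := by omega
  have h2 : i + 3 - 2 = i + 1 := by omega
  rw [h1, h2, pow_succ, pow_add]
  omega

theorem half_le_fejerCoeff {j : ℕ} (hj : 3 ≤ j) {k : ℤ} (hk : k ∈ fejerPeak j) :
    1 / 2 ≤ fejerCoeff j k := by
  obtain ⟨i, rfl⟩ := Nat.exists_eq_add_of_le' hj
  obtain ⟨t, ht, rfl⟩ := Finset.mem_image.1 hk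
  have h1 : i + 3 - 3 = i := by omega
  have h2 : i + 3 - 2 = i + 1 := by omega
  rw [h1, h2, Finset.mem_Ico] at ht
  unfold fejerCoeff
  rw [h2, le_div_iff₀ (by positivity), pow_succ]
  have hsub : (Finset.range (t + 1)).image (fun l => (l, t - l)) ⊆
      (Finset.range (2 ^ (i + 1)) ×ˢ Finset.range (2 ^ (i + 1))).filter fun l =>
        (2:ℤ) ^ (i + 3 - 1) + ((l.1 : ℤ) + l.2) = 2 ^ (i + 3 - 1) + t := by
    intro l hl
    obtain ⟨a, ha, rfl⟩ := Finset.mem_image.1 hl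
    rw [Finset.mem_range] at ha
    rw [Finset.mem_filter, Finset.mem_product, Finset.mem_range, Finset.mem_range]
    refine ⟨⟨by omega, by omega⟩, ?_⟩
    dsimp only
    omega
  have hc := Finset.card_le_card hsub
  rw [Finset.card_image_of_injective _ fun a b h => (Prod.mk.inj h).1, Finset.card_range] at hc
  have h3 := (ht.1.trans (Nat.le_succ t)).trans hc
  rw [mul_comm ((2:ℝ) ^ i), ← mul_assoc, one_div_mul_cancel two_ne_zero, one_mul]
  exact_mod_cast h3

theorem rpow_sum_le_sum_rpow {ι : Type*} (s : Finset ι) (g : ι → ℝ≥0∞) {q : ℝ} (hq0 : 0 < q)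
    (hq1 : q ≤ 1) : (∑ i ∈ s, g i) ^ q ≤ ∑ i ∈ s, g i ^ q :=
  Finset.le_sum_of_subadditive (fun x : ℝ≥0∞ => x ^ q) (ENNReal.zero_rpow_of_pos hq0).le
    (fun a b => ENNReal.rpow_add_le_add_rpow a b hq0.le hq1) s g

theorem lintegral_pi_prod (d : ℕ) {g : Fin d → ℝ → ℝ≥0∞} (hg : ∀ i, Measurable (g i)) :
    ∫⁻ x, ∏ i, g i (x i) ∂(Measure.pi fun _ : Fin d => unitVol) = ∏ i, ∫⁻ t, g i t ∂unitVol := by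
  induction d with
  | zero => simp
  | succ d ih =>
    have hmeas : ∀ (n : ℕ) (h : Fin n → ℝ → ℝ≥0∞), (∀ i, Measurable (h i)) →
        Measurable fun x : Fin n → ℝ => ∏ i, h i (x i) := fun n h hh =>
      Finset.measurable_fun_prod _ fun i _ => (hh i).comp (measurable_pi_apply i)
    rw [lintegral_pi_succ (hmeas _ g hg), Fin.prod_univ_succ, ← ih fun i => hg i.succ,
      ← lintegral_const_mul _ (hmeas _ _ fun i => hg i.succ)]
    refine lintegral_congr fun x' => ?_
    simp only [Fin.prod_univ_succ, Fin.cons_zero, Fin.cons_succ]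
    rw [lintegral_mul_const _ (hg 0)]

/-- Fourier coefficients of `∑_{j ∈ J} ⨂_i fejer (j i)`. -/
def testCoeff {d : ℕ} (k : Fin d → ℤ) : ℝ := ∏ i, fejerCoeff (blockIdx k i) (k i)

/-- The test function `c ∑_{j ∈ J} ⨂_i fejer (j i)`. -/
def testFun (d : ℕ) (J : Finset (Fin d → ℕ)) (c : ℝ) (x : Fin d → ℝ) : ℂ :=
  ∑ k ∈ J.biUnion fun j => Fintype.piFinset fun i => blockF (j i),
    ((c * testCoeff k : ℝ) : ℂ) * expk d k x

theorem fCoeff_testFun (d : ℕ) (J : Finset (Fin d → ℕ)) (c : ℝ) (k : Fin d → ℤ) :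
    fCoeff d (testFun d J c) k = if blockIdx k ∈ J then ((c * testCoeff k : ℝ) : ℂ) else 0 := by
  unfold testFun
  rw [fCoeff_trig]
  have : k ∈ (J.biUnion fun j => Fintype.piFinset fun i => blockF (j i)) ↔ blockIdx k ∈ J := by
    simp_rw [Finset.mem_biUnion, mem_piFinset_blockF]
    simp
  simp_rw [this]

theorem sum_block_testCoeff (d : ℕ) (j : Fin d → ℕ) (c : ℝ) (x : Fin d → ℝ) :
    ∑ k ∈ Fintype.piFinset (fun i => blockF (j i)), ((c * testCoeff k : ℝ) : ℂ) * expk d k x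
      = c * ∏ i, fejer (j i) (x i) := by
  unfold fejer
  rw [Finset.prod_univ_sum, Finset.mul_sum]
  refine Finset.sum_congr rfl fun k hk => ?_
  rw [mem_piFinset_blockF] at hk
  rw [expk_eq_prod, testCoeff, hk, Finset.prod_mul_distrib]
  push_cast
  ring

theorem blockProj_testFun (d : ℕ) (J : Finset (Fin d → ℕ)) (c : ℝ) (j : Fin d → ℕ)
    (x : Fin d → ℝ) :
    blockProj d (testFun d J c) j x = if j ∈ J then c * ∏ i, fejer (j i) (x i) else 0 := by
  unfold blockProj
  simp_rw [fCoeff_testFun]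
  split_ifs with hj
  · rw [← sum_block_testCoeff]
    refine Finset.sum_congr rfl fun k hk => ?_
    rw [mem_piFinset_blockF] at hk
    rw [if_pos (hk ▸ hj)]
  · refine Finset.sum_eq_zero fun k hk => ?_
    rw [mem_piFinset_blockF] at hk
    rw [if_neg (hk ▸ hj), zero_mul]

theorem integrableOn_testFun (d : ℕ) (J : Finset (Fin d → ℕ)) (c : ℝ) :
    IntegrableOn (testFun d J c) (cube d) :=
  integrable_trig d _ _

theorem lintegral_prod_fejer_le {d n : ℕ} {j : Fin d → ℕ} (hj : ∀ i, 3 ≤ j i)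
    (hn : ∑ i, j i = n) {q : ℝ} (hq : 1 ≤ q) :
    ∫⁻ x in cube d, ‖∏ i, fejer (j i) (x i)‖ₑ ^ q ≤ ENNReal.ofReal (2 ^ ((n : ℝ) * (q - 1))) := by
  have h1 : ∀ x : Fin d → ℝ, ‖∏ i, fejer (j i) (x i)‖ₑ ^ q
      = ∏ i, ‖fejer (j i) (x i)‖ₑ ^ q := by
    intro x
    rw [← ofReal_norm, norm_prod, ENNReal.ofReal_prod_of_nonneg fun _ _ => norm_nonneg _,
      ENNReal.prod_rpow_of_nonneg (by linarith)]
    simp_rw [ofReal_norm]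
  simp_rw [h1]
  rw [volume_restrict_cube, lintegral_pi_prod d fun i =>
    (continuous_fejer (j i)).measurable.enorm.pow_const q]
  refine (Finset.prod_le_prod' fun i _ => lintegral_fejer_le (hj i) hq).trans_eq ?_
  rw [← ENNReal.ofReal_prod_of_nonneg fun _ _ => by positivity,
    ← Real.rpow_sum_of_pos two_pos, ← Finset.sum_mul, ← hn]
  push_cast
  rfl

theorem sobolevNorm_testFun_le {d n : ℕ} {J : Finset (Fin d → ℕ)} (hJ3 : ∀ j ∈ J, ∀ i, 3 ≤ j i)
    (hJn : ∀ j ∈ J, ∑ i, j i = n) {p : ℝ≥0∞} (hp1 : 1 < p) (hp2 : p ≤ 2) {s : ℝ}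
    (hs : s ≠ 0 ∨ J.card = 1) {c : ℝ} (hc : 0 < c)
    (hcJ : (c * 2 ^ ((n : ℝ) * s)) ^ p.toReal * (J.card * 2 ^ ((n : ℝ) * (p.toReal - 1))) ≤ 1) :
    sobolevNorm d s p (testFun d J c) ≤ 1 := by
  obtain ⟨hptop, hq1, hq2⟩ := one_lt_toReal_le_two hp1 hp2
  set q := p.toReal with hq
  have hq0 : 0 < q := by linarith
  set D : ℝ := c * 2 ^ ((n : ℝ) * s) with hD
  have hD0 : 0 < D := by positivity
  have hmain : ∑ j ∈ J, ∫⁻ x in cube d, (ENNReal.ofReal D * ‖∏ i, fejer (j i) (x i)‖ₑ) ^ q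
      ≤ 1 := by
    calc _ ≤ ∑ j ∈ J, ENNReal.ofReal (D ^ q) * ENNReal.ofReal (2 ^ ((n : ℝ) * (q - 1))) := by
          refine Finset.sum_le_sum fun j hj => ?_
          simp_rw [ENNReal.mul_rpow_of_nonneg _ _ hq0.le, ENNReal.ofReal_rpow_of_pos hD0]
          rw [lintegral_const_mul' _ _ ENNReal.ofReal_ne_top]
          exact mul_le_mul' le_rfl (lintegral_prod_fejer_le (hJ3 j hj) (hJn j hj) hq1.le)
      _ = ENNReal.ofReal (D ^ q * (J.card * 2 ^ ((n : ℝ) * (q - 1)))) := by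
          rw [Finset.sum_const, nsmul_eq_mul, ENNReal.ofReal_mul (by positivity),
            ENNReal.ofReal_mul (by positivity), ENNReal.ofReal_natCast]
          ring
      _ ≤ 1 := ENNReal.ofReal_le_one.2 hcJ
  by_cases h0 : s = 0
  · subst h0
    obtain ⟨j, rfl⟩ := Finset.card_eq_one.1 (hs.resolve_left (by simp))
    rw [sobolevNorm, if_pos rfl, LqNorm, eLpNorm_eq_lintegral_rpow_enorm_toReal
      (by rintro rfl; simp at hp1) hptop]
    refine ENNReal.rpow_le_one ?_ (by positivity)
    refine le_trans (le_of_eq ?_) hmain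
    rw [Finset.sum_singleton]
    refine lintegral_congr fun x => ?_
    have : testFun d {j} c x = c * ∏ i, fejer (j i) (x i) := by
      rw [testFun, Finset.singleton_biUnion, sum_block_testCoeff]
    rw [this, enorm_mul, hD, mul_zero, Real.rpow_zero, mul_one, ← ofReal_norm (c : ℂ),
      Complex.norm_real, Real.norm_of_nonneg hc.le]
  · rw [sobolevNorm, if_neg h0]
    refine ENNReal.rpow_le_one ?_ (by positivity)
    refine le_trans ?_ hmain
    rw [← lintegral_finsetSum' _ fun j _ => ?_]
    · refine lintegral_mono fun x => ?_
      rw [tsum_eq_sum (s := J) (fun j hj => by rw [blockProj_testFun, if_neg hj]; simp),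
        ← ENNReal.rpow_mul]
      refine (rpow_sum_le_sum_rpow _ _ (by positivity) (by linarith)).trans ?_
      refine Finset.sum_le_sum fun j hj => le_of_eq ?_
      rw [← ENNReal.rpow_natCast, ← ENNReal.rpow_mul, blockProj_testFun, if_pos hj, hJn j hj, hD,
        mul_comm c, ENNReal.ofReal_mul (by positivity), mul_assoc]
      congr 1
      · congr 1
        have : ∀ z : ℂ, (‖z‖₊ : ℝ≥0∞) = ‖z‖ₑ := fun z => rfl
        rw [this, enorm_mul, ← ofReal_norm (c : ℂ), Complex.norm_real, Real.norm_of_nonneg hc.le]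
      · push_cast; ring
    · refine (Measurable.const_mul (Measurable.enorm ?_) _).pow_const _ |>.aemeasurable
      exact Finset.measurable_fun_prod _ fun i _ =>
        (continuous_fejer (j i)).measurable.comp (measurable_pi_apply i)

theorem le_sigmaF {d m : ℕ} {f : (Fin d → ℝ) → ℂ} (hf : IntegrableOn f (cube d)) (hm : 1 ≤ m)
    {t : ℝ} (ht : 0 ≤ t) (G : Finset (Fin d → ℤ)) (hG : 2 * m ≤ G.card)
    (hGt : ∀ k ∈ G, t ≤ ‖fCoeff d f k‖) {η : ℝ≥0∞} (hη : η ≠ 0) :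
    ENNReal.ofReal (t * (m : ℝ) ^ (1 / η.toReal)) ≤ sigmaF d m (wienerNorm d 0 η) f := by
  refine le_iInf₂ fun s hs => ?_
  obtain ⟨Λ, a, hΛ, rfl⟩ := hs
  have hcard : m ≤ (G \ Λ).card := by
    have := Finset.le_card_sdiff Λ G
    omega
  have hcoef : ∀ k ∈ G \ Λ, ENNReal.ofReal t ≤
      ENNReal.ofReal (wt d k ^ (0:ℝ)) *
        (‖fCoeff d (f - fun x => ∑ k ∈ Λ, a k * expk d k x) k‖₊ : ℝ≥0∞) := by
    intro k hk
    rw [Finset.mem_sdiff] at hk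
    rw [fCoeff_sub d hf (integrable_trig d _ _), fCoeff_trig, if_neg hk.2, sub_zero,
      Real.rpow_zero, ENNReal.ofReal_one, one_mul]
    refine (ENNReal.ofReal_le_ofReal (hGt k hk.1)).trans_eq ?_
    rw [ofReal_norm]; rfl
  unfold wienerNorm
  split_ifs with htop
  · subst htop
    obtain ⟨k, hk⟩ := Finset.card_pos.1 (hm.trans hcard)
    refine le_trans ?_ (le_iSup_of_le k (hcoef k hk))
    simp
  · have hη0 : 0 < η.toReal := ENNReal.toReal_pos hη htop
    refine le_trans ?_ (ENNReal.rpow_le_rpow (ENNReal.sum_le_tsum (G \ Λ)) (by positivity))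
    refine le_trans ?_ (ENNReal.rpow_le_rpow (Finset.sum_le_sum fun k hk =>
      ENNReal.rpow_le_rpow (hcoef k hk) hη0.le) (by positivity))
    rw [Finset.sum_const, nsmul_eq_mul, ENNReal.mul_rpow_of_nonneg _ _ (by positivity),
      ← ENNReal.rpow_mul, mul_one_div_cancel hη0.ne', ENNReal.rpow_one, mul_comm,
      ENNReal.ofReal_mul' (by positivity)]
    refine mul_le_mul' ?_ le_rfl
    rw [← ENNReal.ofReal_rpow_of_nonneg (by positivity) (by positivity), ENNReal.ofReal_natCast]
    exact ENNReal.rpow_le_rpow (by exact_mod_cast hcard) (by positivity)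

theorem le_sigmaClass_of_family {d n m : ℕ} {J : Finset (Fin d → ℕ)}
    (hJ3 : ∀ j ∈ J, ∀ i, 3 ≤ j i) (hJn : ∀ j ∈ J, ∑ i, j i = n) (hJ0 : 0 < J.card)
    {p η : ℝ≥0∞} (hp1 : 1 < p) (hp2 : p ≤ 2) (hη : η ≠ 0) {s : ℝ}
    (hs : s ≠ 0 ∨ J.card = 1) (hm : 1 ≤ m) (hmJ : 2 * m * 8 ^ d ≤ J.card * 2 ^ n) :
    ENNReal.ofReal ((1 / 2) ^ d * ((J.card : ℝ) ^ (-(1 / p.toReal)) *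
      2 ^ (-((n : ℝ) * (s + 1 - 1 / p.toReal)))) * (m : ℝ) ^ (1 / η.toReal))
      ≤ sigmaClass d m (sobolevNorm d s p) (wienerNorm d 0 η) := by
  obtain ⟨hptop, hq1, hq2⟩ := one_lt_toReal_le_two hp1 hp2
  set q := p.toReal with hq
  have hq0 : 0 < q := by linarith
  have hJ0' : (0:ℝ) < J.card := by exact_mod_cast hJ0
  set c : ℝ := (J.card : ℝ) ^ (-(1 / q)) * 2 ^ (-((n : ℝ) * (s + 1 - 1 / q))) with hc
  have hc0 : 0 < c := by positivity
  have hcJ : (c * 2 ^ ((n : ℝ) * s)) ^ q * (J.card * 2 ^ ((n : ℝ) * (q - 1))) ≤ 1 := by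
    have h1 : c * 2 ^ ((n : ℝ) * s) = (J.card : ℝ) ^ (-(1 / q)) * 2 ^ (-((n : ℝ) * (1 - 1 / q))) := by
      rw [hc, mul_assoc, ← Real.rpow_add two_pos]
      congr 2; ring
    rw [h1, Real.mul_rpow (by positivity) (by positivity), ← Real.rpow_mul hJ0'.le,
      ← Real.rpow_mul two_pos.le]
    have h2 : -(1 / q) * q = -1 := by field_simp
    have h3 : -((n : ℝ) * (1 - 1 / q)) * q = -((n : ℝ) * (q - 1)) := by field_simp
    rw [h2, h3, Real.rpow_neg two_pos.le, Real.rpow_neg_one]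
    have h4 : (0:ℝ) < 2 ^ ((n : ℝ) * (q - 1)) := by positivity
    refine le_of_eq ?_
    field_simp
  have hball : testFun d J c ∈ unitBall d (sobolevNorm d s p) :=
    ⟨integrableOn_testFun d J c, sobolevNorm_testFun_le hJ3 hJn hp1 hp2 hs hc0 hcJ⟩
  refine le_trans ?_ (le_iSup₂_of_le _ hball le_rfl)
  set G := J.biUnion fun j => Fintype.piFinset fun i => fejerPeak (j i) with hG
  have hidx : ∀ j ∈ J, ∀ k ∈ Fintype.piFinset (fun i => fejerPeak (j i)), blockIdx k = j := by
    intro j hj k hk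
    rw [← mem_piFinset_blockF]
    rw [Fintype.mem_piFinset] at hk ⊢
    exact fun i => fejerPeak_subset (hJ3 j hj i) (hk i)
  have hcard : 8 ^ d * G.card = J.card * 2 ^ n := by
    rw [hG, Finset.card_biUnion, Finset.mul_sum, Finset.sum_congr rfl (g := fun _ => 2 ^ n),
      Finset.sum_const, smul_eq_mul]
    · intro j hj
      rw [Fintype.card_piFinset, ← hJn j hj, ← Finset.prod_pow_eq_pow_sum,
        ← Finset.prod_congr rfl fun i _ => card_fejerPeak (hJ3 j hj i), Finset.prod_mul_distrib]
      simp
    · intro j hj j' hj' hne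
      refine Finset.disjoint_left.2 ?_
      exact fun k hk hk' => hne ((hidx j hj k hk).symm.trans (hidx j' hj' k hk'))
  have hGm : 2 * m ≤ G.card := by
    have h8 : 0 < 8 ^ d := by positivity
    refine Nat.le_of_mul_le_mul_left ?_ h8
    rw [hcard, mul_comm]; exact hmJ
  rw [mul_comm ((1 / 2 : ℝ) ^ d)]
  refine le_sigmaF hball.1 hm (by positivity) G hGm ?_ hη
  intro k hk
  obtain ⟨j, hj, hkj⟩ := Finset.mem_biUnion.1 hk
  have hb := hidx j hj k hkj
  have htest : 0 ≤ testCoeff k := Finset.prod_nonneg fun i _ => fejerCoeff_nonneg _ _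
  rw [fCoeff_testFun, if_pos (hb ▸ hj), Complex.norm_real,
    Real.norm_of_nonneg (mul_nonneg hc0.le htest)]
  refine mul_le_mul_of_nonneg_left ?_ hc0.le
  have : ((1 / 2 : ℝ)) ^ d = ∏ _i : Fin d, (1 / 2 : ℝ) := by simp
  rw [this, testCoeff]
  refine Finset.prod_le_prod (fun _ _ => by norm_num) fun i _ => ?_
  rw [hb]
  exact half_le_fejerCoeff (hJ3 j hj i) (Fintype.mem_piFinset.1 hkj i)

theorem exists_family (e L n : ℕ) (hn : e * (L + 2) + 3 ≤ n) :
    ∃ J : Finset (Fin (e + 1) → ℕ), J.card = L ^ e ∧ (∀ j ∈ J, ∀ i, 3 ≤ j i) ∧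
      ∀ j ∈ J, ∑ i, j i = n := by
  set F : (Fin e → ℕ) → (Fin (e + 1) → ℕ) := fun u =>
    Fin.cons (n - ∑ i, (3 + u i)) fun i => 3 + u i with hF
  have hinj : Function.Injective F := by
    intro u v h
    funext i
    have := congrFun h i.succ
    simpa [hF] using this
  have hsum : ∀ u ∈ Fintype.piFinset (fun _ : Fin e => Finset.range L),
      ∑ i, (3 + u i) + 3 ≤ n := by
    intro u hu
    refine le_trans (Nat.add_le_add_right ?_ 3) hn
    refine (Finset.sum_le_card_nsmul _ _ (L + 2) fun i _ => ?_).trans (by simp)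
    have := Finset.mem_range.1 (Fintype.mem_piFinset.1 hu i)
    omega
  refine ⟨(Fintype.piFinset fun _ : Fin e => Finset.range L).image F, ?_, ?_, ?_⟩
  · rw [Finset.card_image_of_injective _ hinj]; simp [Fintype.card_piFinset]
  · intro j hj i
    obtain ⟨u, hu, rfl⟩ := Finset.mem_image.1 hj
    have := hsum u hu
    refine Fin.cases ?_ (fun i => ?_) i
    · simp only [hF, Fin.cons_zero]; omega
    · simp only [hF, Fin.cons_succ]; omega
  · intro j hj
    obtain ⟨u, hu, rfl⟩ := Finset.mem_image.1 hj
    have := hsum u hu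
    simp only [hF, Fin.sum_univ_succ, Fin.cons_zero, Fin.cons_succ]
    omega

theorem le_sigmaClass_of_layers (e L m : ℕ) (hL : 1 ≤ L) {p η : ℝ≥0∞} (hp1 : 1 < p) (hp2 : p ≤ 2)
    (hη : η ≠ 0) {s : ℝ} (hs0 : 0 ≤ s) (hs : s ≠ 0 ∨ L = 1) (hm : 1 ≤ m)
    (hLm : 2 ^ (2 * e * L) ≤ m) :
    ENNReal.ofReal ((1 / 2) ^ (e + 1) * (2 ^ (3 * e + 5)) ^ (-(s + 1 - 1 / p.toReal)) *
      ((m : ℝ) ^ (-(s + 1 - 1 / p.toReal - 1 / η.toReal)) *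
        (L : ℝ) ^ ((e : ℝ) * (s + 1 - 2 / p.toReal))))
      ≤ sigmaClass (e + 1) m (sobolevNorm (e + 1) s p) (wienerNorm (e + 1) 0 η) := by
  obtain ⟨hptop, hq1, hq2⟩ := one_lt_toReal_le_two hp1 hp2
  set q := p.toReal with hq
  have hq0 : 0 < q := by linarith
  have hL0 : (0:ℝ) < L := by exact_mod_cast hL
  have hm0 : (0:ℝ) < m := by exact_mod_cast hm
  have hLpow : L ^ e * 2 ^ (e * L) ≤ m := by
    refine le_trans ?_ hLm
    have h1 : L ^ e ≤ 2 ^ (e * L) := by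
      rw [mul_comm, pow_mul]
      exact Nat.pow_le_pow_left Nat.lt_two_pow_self.le e
    calc L ^ e * 2 ^ (e * L) ≤ 2 ^ (e * L) * 2 ^ (e * L) := Nat.mul_le_mul_right _ h1
      _ = 2 ^ (2 * e * L) := by rw [← pow_add]; congr 1; ring
  set y : ℝ := 2 ^ (3 * e + 4) * m / (L : ℝ) ^ e with hy
  have hLe0 : (0:ℝ) < (L : ℝ) ^ e := by positivity
  have hylow : (2:ℝ) ^ (e * (L + 2) + 3) ≤ y := by
    rw [hy, le_div_iff₀ hLe0]
    have h1 : ((L : ℝ) ^ e * 2 ^ (e * L)) ≤ m := by exact_mod_cast hLpow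
    calc (2:ℝ) ^ (e * (L + 2) + 3) * (L : ℝ) ^ e = 2 ^ (2 * e + 3) * (L ^ e * 2 ^ (e * L)) := by
          rw [show e * (L + 2) + 3 = (2 * e + 3) + e * L by ring, pow_add]; ring
      _ ≤ 2 ^ (3 * e + 4) * m := by
          gcongr
          · exact one_le_two
          · omega
          · omega
  have hy1 : 1 ≤ y := (one_le_pow₀ one_le_two).trans hylow
  obtain ⟨n', hn1, hn2⟩ := exists_nat_pow_near hy1 one_lt_two
  have hn : e * (L + 2) + 3 ≤ n' + 1 :=
    ((pow_lt_pow_iff_right₀ (one_lt_two (α := ℝ))).1 (hylow.trans_lt hn2)).le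
  obtain ⟨J, hJc, hJ3, hJn⟩ := exists_family e L (n' + 1) hn
  have hfam := le_sigmaClass_of_family (m := m) (n := n' + 1) hJ3 hJn
    (by rw [hJc]; positivity) hp1 hp2 hη (s := s)
    (hs.imp_right fun h => by rw [hJc, h, one_pow]) hm ?_
  · refine le_trans (ENNReal.ofReal_le_ofReal ?_) hfam
    rw [hJc, ← hq]
    set a := s + 1 - 1 / q with ha
    have hq' : 1 / q ≤ 1 := by rw [div_le_one hq0]; exact hq1.le
    have ha0 : 0 ≤ a := by rw [ha]; linarith
    have h2n : (2:ℝ) ^ (n' + 1) ≤ 2 ^ (3 * e + 5) * m / (L : ℝ) ^ e := by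
      rw [pow_succ]
      calc (2:ℝ) ^ n' * 2 ≤ y * 2 := by gcongr
        _ = _ := by rw [hy, pow_succ 2 (3 * e + 4)]; ring
    have h2a : (2 ^ (3 * e + 5) * m / (L : ℝ) ^ e) ^ (-a) ≤
        (2:ℝ) ^ (-(((n' + 1 : ℕ) : ℝ) * a)) := by
      rw [← mul_neg, Real.rpow_mul two_pos.le, Real.rpow_natCast]
      exact Real.rpow_le_rpow_of_nonpos (by positivity) h2n (by linarith)
    have h3 : (2 ^ (3 * e + 5) * m / (L : ℝ) ^ e) ^ (-a)
        = (2 ^ (3 * e + 5)) ^ (-a) * (m : ℝ) ^ (-a) * (L : ℝ) ^ ((e : ℝ) * a) := by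
      rw [Real.div_rpow (by positivity) hLe0.le, Real.mul_rpow (by positivity) hm0.le,
        Real.rpow_neg hLe0.le, div_inv_eq_mul, Real.rpow_mul hL0.le, Real.rpow_natCast]
    have h4 : (((L ^ e : ℕ) : ℝ)) ^ (-(1 / q)) = (L : ℝ) ^ ((e : ℝ) * (-(1 / q))) := by
      rw [Real.rpow_mul hL0.le, Real.rpow_natCast]; push_cast; rfl
    have h5 : (m : ℝ) ^ (-(a - 1 / η.toReal)) = (m : ℝ) ^ (-a) * (m : ℝ) ^ (1 / η.toReal) := by
      rw [← Real.rpow_add hm0]; congr 1; ring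
    have h6 : (L : ℝ) ^ ((e : ℝ) * (s + 1 - 2 / q))
        = (L : ℝ) ^ ((e : ℝ) * (-(1 / q))) * (L : ℝ) ^ ((e : ℝ) * a) := by
      rw [← Real.rpow_add hL0]; congr 1; rw [ha]; ring
    rw [h4, h5, h6]
    calc _ = (1 / 2) ^ (e + 1) * ((L : ℝ) ^ ((e : ℝ) * (-(1 / q))) *
          ((2 ^ (3 * e + 5)) ^ (-a) * (m : ℝ) ^ (-a) * (L : ℝ) ^ ((e : ℝ) * a))) *
          (m : ℝ) ^ (1 / η.toReal) := by ring
      _ ≤ _ := by rw [← h3]; gcongr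
  · rw [hJc]
    have h1 : 2 ^ (3 * e + 4) * (m : ℝ) ≤ (L : ℝ) ^ e * 2 ^ (n' + 1) := by
      rw [← div_le_iff₀' hLe0]; exact hn2.le
    have h2 : 2 ^ (3 * e + 4) * m ≤ L ^ e * 2 ^ (n' + 1) := by exact_mod_cast h1
    refine le_trans (le_of_eq ?_) h2
    rw [show 8 = 2 ^ 3 by norm_num, ← pow_mul, show 3 * e + 4 = 3 * (e + 1) + 1 by ring, pow_succ]
    ring

theorem exists_layers (e : ℕ) : ∃ K : ℝ, 0 < K ∧ ∃ m₀ : ℕ, 1 ≤ m₀ ∧ ∀ m : ℕ, m₀ ≤ m →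
    ∃ L : ℕ, 1 ≤ L ∧ 2 ^ (2 * e * L) ≤ m ∧ logStar m ≤ K * L := by
  refine ⟨2 * (2 * e + 1), by positivity, 2 ^ (2 * e + 1), Nat.one_le_two_pow, fun m hm => ?_⟩
  have hm0 : m ≠ 0 := by have := Nat.one_le_two_pow (n := 2 * e + 1); omega
  have hlog : 2 * e + 1 ≤ Nat.log 2 m := Nat.le_log_of_pow_le one_lt_two hm
  set L := Nat.log 2 m / (2 * e + 1) with hL
  have hL1 : 1 ≤ L := (Nat.one_le_div_iff (by omega)).2 hlog
  have hL2 : (2 * e + 1) * L ≤ Nat.log 2 m := Nat.mul_div_le _ _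
  have hL3 : Nat.log 2 m + 1 ≤ (2 * e + 1) * (L + 1) := Nat.lt_mul_div_succ _ (by omega)
  refine ⟨L, hL1, ?_, ?_⟩
  · refine le_trans (Nat.pow_le_pow_right two_pos ?_) (Nat.pow_log_le_self 2 hm0)
    refine le_trans (Nat.mul_le_mul_right L (by omega)) hL2
  · have h1 : (1:ℝ) ≤ L := by exact_mod_cast hL1
    have he : (0:ℝ) ≤ e := by positivity
    refine max_le ?_ (by nlinarith)
    have h2 : Real.logb 2 m ≤ (Nat.log 2 m + 1 : ℕ) := by
      rw [Real.logb_le_iff_le_rpow one_lt_two (by positivity), Real.rpow_natCast]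
      exact_mod_cast (Nat.lt_pow_succ_log_self one_lt_two m).le
    refine h2.trans ?_
    have h3 : ((Nat.log 2 m + 1 : ℕ) : ℝ) ≤ (2 * e + 1) * (L + 1) := by exact_mod_cast hL3
    nlinarith

/-- `σ_m(S^r_p W)_{A_η}` for `1 < p ≤ 2`; part (1) for
`p ≤ η ≤ ∞`, `r > 2/p - 1`, part (2) for `p < η ≤ ∞`, `r = 2/p - 1`. -/
theorem statement16 (d : ℕ) (hd : 1 ≤ d) (p : ℝ≥0∞) (hp1 : 1 < p) (hp2 : p ≤ 2) :
    (∀ η : ℝ≥0∞, p ≤ η → ∀ r : ℝ, 2/p.toReal - 1 < r →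
      IsAsympEquiv (fun m => sigmaClass d m (sobolevNorm d r p) (wienerNorm d 0 η))
        (fun m => (m : ℝ) ^ (-(r + 1 - 1/p.toReal - 1/η.toReal)) *
          logStar m ^ (((d : ℝ) - 1) * (r + 1 - 2/p.toReal)))) ∧
    (∀ η : ℝ≥0∞, p < η →
      IsAsympEquiv (fun m => sigmaClass d m
          (sobolevNorm d (2/p.toReal - 1) p) (wienerNorm d 0 η))
        (fun m => (m : ℝ) ^ (-(1/p.toReal - 1/η.toReal)))) := by
  obtain ⟨e, rfl⟩ := Nat.exists_eq_add_of_le' hd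
  obtain ⟨hptop, hq1, hq2⟩ := one_lt_toReal_le_two hp1 hp2
  have hr0 : 0 ≤ 2 / p.toReal - 1 := by
    rw [sub_nonneg, one_le_div (by linarith)]; exact hq2
  have hη0 : ∀ η : ℝ≥0∞, p ≤ η → η ≠ 0 := fun η hη =>
    ((zero_lt_one.trans hp1).trans_le hη).ne'
  constructor
  · intro η hη r hr
    obtain ⟨C, hC, m₁, hup⟩ := sigmaClass_le e hp1 hp2 hη hr
    obtain ⟨K, hK, m₂, hm₂, hlay⟩ := exists_layers e
    have hd1 : (((e + 1 : ℕ) : ℝ) - 1) = e := by push_cast; ring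
    set δ := r + 1 - 2 / p.toReal with hδ
    have hδ0 : 0 ≤ δ := by rw [hδ]; linarith
    set B : ℝ := (1 / 2) ^ (e + 1) * (2 ^ (3 * e + 5)) ^ (-(r + 1 - 1 / p.toReal)) with hB
    have hB0 : 0 < B := by positivity
    refine ⟨B / K ^ ((e : ℝ) * δ), C, by positivity, hC, max m₁ m₂, fun m hm => ⟨?_, ?_⟩⟩
    · obtain ⟨L, hL1, hLm, hLK⟩ := hlay m ((le_max_right _ _).trans hm)
      have hm1 : 1 ≤ m := hm₂.trans ((le_max_right _ _).trans hm)
      refine le_trans (ENNReal.ofReal_le_ofReal ?_)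
        (le_sigmaClass_of_layers e L m hL1 hp1 hp2 (hη0 η hη) (hr0.trans hr.le)
          (Or.inl (by linarith)) hm1 hLm)
      rw [hd1, ← hδ, ← hB]
      beta_reduce
      have h1 : logStar m ^ ((e : ℝ) * δ) ≤ K ^ ((e : ℝ) * δ) * (L : ℝ) ^ ((e : ℝ) * δ) := by
        rw [← Real.mul_rpow hK.le (by positivity)]
        exact Real.rpow_le_rpow (zero_le_one.trans (one_le_logStar m)) hLK (by positivity)
      have hK0 : 0 < K ^ ((e : ℝ) * δ) := by positivity
      calc _ ≤ B / K ^ ((e : ℝ) * δ) * ((m : ℝ) ^ (-(r + 1 - 1 / p.toReal - 1 / η.toReal)) *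
            (K ^ ((e : ℝ) * δ) * (L : ℝ) ^ ((e : ℝ) * δ))) := by gcongr
        _ = _ := by field_simp
    · rw [hd1]
      exact hup m ((le_max_left _ _).trans hm)
  · intro η hη
    obtain ⟨C, hC, hup⟩ := sigmaClass_le_critical (e + 1) hp1 hp2 hη.le
    have ha : 2 / p.toReal - 1 + 1 - 1 / p.toReal = 1 / p.toReal := by ring
    refine ⟨(1 / 2) ^ (e + 1) * (2 ^ (3 * e + 5)) ^ (-(1 / p.toReal)), C, by positivity, hC,
      2 ^ (2 * e), fun m hm => ?_⟩
    have hm1 : 1 ≤ m := Nat.one_le_two_pow.trans hm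
    refine ⟨?_, hup m hm1⟩
    have := le_sigmaClass_of_layers e 1 m le_rfl hp1 hp2 (hη0 η hη.le) hr0 (Or.inr rfl) hm1
      (by rwa [mul_one])
    rwa [ha, Nat.cast_one, Real.one_rpow, mul_one] at this

end Paper
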